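/- arXiv:2303.02520 — 2 statements merged into one kernel-verified Lean document; each statement's English description precedes it below -/
import Mathlib

section
/- Let k be a positive integer, let ν ∈ ℂ with Re(ν) > −1, and let β ∈ ℂ with Re(√β) > 0. Then Γ(ν+1)/(2π^{ν+1}β^{(ν+1)/2}) + ∑_{n=1}^∞ r_k(n) n^{(ν+1)/2} K_{ν+1}(2π√(nβ)) = (β^{(ν+1)/2} Γ(ν+1+k/2)/(2π^{k/2+ν+1})) ∑_{n=0}^∞ r_k(n)/(β+n)^{k/2+ν+1}, both series converging absolutely (all powers and square roots are principal branches; the first term on the left is the n = 0 term of the series interpreted as the limit lim_{x→0+} x^{(ν+1)/2} K_{ν+1}(2π√(xβ))). -/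
open MeasureTheory Filter Complex

/-- The modified Bessel function of the second kind `K_ν(z)` for `ν, z ∈ ℂ` with `Re z > 0`,
`K_ν(z) = ∫_0^∞ e^{-z cosh t} cosh(ν t) dt`. -/
noncomputable def besselK (ν z : ℂ) : ℂ :=
  ∫ t in Set.Ioi (0:ℝ), Complex.exp (-z * Real.cosh t) * Complex.cosh (ν * t)

/-- `r_k(n)`: the number of `k`-tuples of integers whose squares sum to `n`. -/
noncomputable def sqRep (k n : ℕ) : ℕ := Nat.card {a : Fin k → ℤ // ∑ i, (a i)^2 = (n : ℤ)}

/-- The sum of squares of an integer tuple, as a natural number. -/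
def sumSq {k : ℕ} (a : Fin k → ℤ) : ℕ := ∑ i, (a i).natAbs ^ 2

theorem sumSq_cast {k : ℕ} (a : Fin k → ℤ) : ((sumSq a : ℕ) : ℤ) = ∑ i, (a i) ^ 2 := by
  simp [sumSq]

theorem sumSq_cast_real {k : ℕ} (a : Fin k → ℤ) :
    ((sumSq a : ℕ) : ℝ) = ∑ i, ((a i : ℤ) : ℝ) ^ 2 := by
  have h := congrArg (Int.cast : ℤ → ℝ) (sumSq_cast a)
  push_cast at h
  exact h

theorem sq_le_sumSq {k : ℕ} (a : Fin k → ℤ) (i : Fin k) :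
    ((a i : ℤ) : ℝ) ^ 2 ≤ (sumSq a : ℕ) := by
  rw [sumSq_cast_real]
  exact Finset.single_le_sum (f := fun i => ((a i : ℤ) : ℝ) ^ 2)
    (fun j _ => sq_nonneg _) (Finset.mem_univ i)

theorem sqRep_eq_card_fiber (k n : ℕ) :
    sqRep k n = Nat.card {a : Fin k → ℤ // sumSq a = n} := by
  unfold sqRep
  refine Nat.card_congr (Equiv.subtypeEquivRight fun a => ?_)
  rw [← sumSq_cast]
  exact Int.ofNat_inj

theorem finite_sumSq_fiber (k n : ℕ) : Finite {a : Fin k → ℤ // sumSq a = n} := by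
  have hfin : (Set.univ.pi fun _ : Fin k => Set.Icc (-(n : ℤ)) n).Finite :=
    Set.Finite.pi' (fun _ => Set.finite_Icc _ _) |>.subset (by intro a ha i; exact ha i trivial)
  refine (hfin.subset ?_ : Set.Finite {a : Fin k → ℤ | sumSq a = n})
  intro a ha i _
  have h1 : (a i).natAbs ^ 2 ≤ n := by
    rw [← (show sumSq a = n from ha)]
    exact Finset.single_le_sum (f := fun i => (a i).natAbs ^ 2)
      (fun j _ => Nat.zero_le _) (Finset.mem_univ i)
  have h2 : (a i).natAbs ≤ n := (Nat.le_self_pow two_ne_zero _).trans h1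
  simp only [Set.mem_Icc]
  omega

theorem sqRep_zero (k : ℕ) : sqRep k 0 = 1 := by
  rw [sqRep_eq_card_fiber, Nat.card_eq_one_iff_unique]
  have h0 : ∀ a : Fin k → ℤ, sumSq a = 0 → a = 0 := by
    intro a ha
    funext i
    simpa [sumSq] using (Finset.sum_eq_zero_iff.mp ha) i (Finset.mem_univ i)
  exact ⟨⟨fun a b => Subtype.ext ((h0 a a.2).trans (h0 b b.2).symm)⟩, ⟨⟨0, by simp [sumSq]⟩⟩⟩

theorem HasSum.sqRep_mul {k : ℕ} {f : ℕ → ℝ} {S : ℝ}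
    (h : HasSum (fun a : Fin k → ℤ => f (sumSq a)) S) :
    HasSum (fun n => (sqRep k n : ℝ) * f n) S := by
  rw [← (Equiv.sigmaFiberEquiv (sumSq (k := k))).hasSum_iff] at h
  refine h.sigma fun n => ?_
  have := finite_sumSq_fiber k n
  have := Fintype.ofFinite {a : Fin k → ℤ // sumSq a = n}
  have h2 := hasSum_fintype fun c : {a : Fin k → ℤ // sumSq a = n} =>
    f (sumSq (Equiv.sigmaFiberEquiv (sumSq (k := k)) ⟨n, c⟩))
  convert! h2 using 1
  rw [Finset.sum_congr rfl (g := fun _ => f n) (fun c _ => congrArg f c.2)]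
  simp [sqRep_eq_card_fiber, Nat.card_eq_fintype_card]

theorem HasSum.prod_fin {g : ℤ → ℝ} {S : ℝ} (hg : ∀ m, 0 ≤ g m) (h : HasSum g S) (k : ℕ) :
    HasSum (fun a : Fin k → ℤ => ∏ i, g (a i)) (S ^ k) := by
  induction k with
  | zero => simp
  | succ k ih =>
    have hs := h.summable.mul_of_nonneg ih.summable hg
      (fun a => Finset.prod_nonneg fun i _ => hg _)
    have h2 := h.mul ih hs
    rw [← (Fin.consEquiv fun _ : Fin (k + 1) => ℤ).hasSum_iff, pow_succ']
    convert! h2 using 1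
    funext x
    simp [Fin.consEquiv, Fin.prod_univ_succ]

theorem summable_exp_neg_mul_int_sq {x : ℝ} (hx : 0 < x) :
    Summable fun m : ℤ => Real.exp (-Real.pi * x * (m : ℝ) ^ 2) := by
  have h := ((summable_jacobiTheta₂_term_iff 0 ((x : ℂ) * I)).mpr (by simpa using hx)).norm
  refine h.congr fun m => ?_
  rw [norm_jacobiTheta₂_term]
  congr 1
  simp
  ring

theorem hasSum_sqRep_mul_exp (k : ℕ) {x : ℝ} (hx : 0 < x) :
    HasSum (fun n : ℕ => (sqRep k n : ℝ) * Real.exp (-Real.pi * x * n))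
      ((∑' m : ℤ, Real.exp (-Real.pi * x * (m : ℝ) ^ 2)) ^ k) := by
  refine HasSum.sqRep_mul (f := fun n : ℕ => Real.exp (-Real.pi * x * n)) ?_
  have h := (summable_exp_neg_mul_int_sq hx).hasSum.prod_fin (fun m => (Real.exp_pos _).le) k
  simpa only [← Real.exp_sum, sumSq_cast_real, Finset.mul_sum] using h

/-- The transformation law of the `k`-th power of the theta function. -/
theorem hasSum_sqRep_mul_exp_inv (k : ℕ) {x : ℝ} (hx : 0 < x) :
    HasSum (fun n : ℕ => (sqRep k n : ℝ) * Real.exp (-Real.pi * n / x))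
      (x ^ ((k : ℝ) / 2) * ∑' n : ℕ, (sqRep k n : ℝ) * Real.exp (-Real.pi * x * n)) := by
  have h := hasSum_sqRep_mul_exp k (inv_pos.mpr hx)
  rw [(hasSum_sqRep_mul_exp k hx).tsum_eq, Real.tsum_exp_neg_mul_int_sq hx, mul_pow,
    ← mul_assoc]
  have h1 : x ^ ((k : ℝ) / 2) * (1 / x ^ (1 / 2 : ℝ)) ^ k = 1 := by
    rw [div_pow, one_pow, ← Real.rpow_natCast, ← Real.rpow_mul hx.le,
      one_div_mul_eq_div, mul_one_div, div_self (Real.rpow_pos_of_pos hx _).ne']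
  rw [h1, one_mul]
  convert! h using 4; ring

theorem summable_one_add_int_sq_rpow {p : ℝ} (hp : 1 / 2 < p) :
    Summable fun m : ℤ => (1 + (m : ℝ) ^ 2) ^ (-p) := by
  have h := Real.summable_abs_int_rpow (b := 2 * p) (by linarith)
  refine Summable.of_norm_bounded_eventually (g := fun m : ℤ => |(m : ℝ)| ^ (-(2 * p))) h ?_
  rw [Filter.eventually_cofinite]
  refine (Set.finite_singleton (0 : ℤ)).subset fun m hm => ?_
  by_contra hm0
  refine hm ?_
  have hm1 : (m : ℝ) ≠ 0 := by exact_mod_cast hm0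
  rw [Real.norm_of_nonneg (by positivity), show -(2 * p) = 2 * (-p) by ring,
    Real.rpow_mul (abs_nonneg _), Real.rpow_two, sq_abs]
  exact Real.rpow_le_rpow_of_nonpos (by positivity) (by linarith) (by linarith)

theorem summable_sqRep_mul_rpow {k : ℕ} (hk : 0 < k) {s : ℝ} (hs : (k : ℝ) / 2 < s) :
    Summable fun n : ℕ => (sqRep k n : ℝ) * (1 + (n : ℝ)) ^ (-s) := by
  have hk' : (0 : ℝ) < k := by exact_mod_cast hk
  have h1 := (summable_one_add_int_sq_rpow (p := s / k)
    (by rw [lt_div_iff₀ hk']; linarith)).hasSum.prod_fin (fun m => by positivity) k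
  have h2 : Summable fun a : Fin k → ℤ => (1 + ((sumSq a : ℕ) : ℝ)) ^ (-s) := by
    refine Summable.of_nonneg_of_le (fun a => by positivity) (fun a => ?_) h1.summable
    have h3 : (1 + ((sumSq a : ℕ) : ℝ)) ^ (-s)
        = ∏ _i : Fin k, (1 + ((sumSq a : ℕ) : ℝ)) ^ (-(s / k)) := by
      rw [Finset.prod_const, Finset.card_univ, Fintype.card_fin, ← Real.rpow_natCast,
        ← Real.rpow_mul (by positivity)]
      congr 1
      field_simp
    rw [h3]
    refine Finset.prod_le_prod (fun i _ => by positivity) fun i _ => ?_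
    refine Real.rpow_le_rpow_of_nonpos (by positivity) (by linarith [sq_le_sumSq a i]) ?_
    have : 0 < s / k := div_pos (by linarith [div_pos hk' two_pos]) hk'
    linarith
  exact (HasSum.sqRep_mul (f := fun n : ℕ => (1 + (n : ℝ)) ^ (-s)) h2.hasSum).summable

theorem exp_neg_mul_cosh_mul_exp_le {a : ℝ} (ha : 0 < a) (b : ℝ) {t : ℝ} (ht : 0 ≤ t) :
    Real.exp (-a * Real.cosh t) * Real.exp (b * t)
      ≤ Real.exp ((b + 1) ^ 2 / a) * Real.exp (-t) := by
  rw [← Real.exp_add, ← Real.exp_add, Real.exp_le_exp]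
  have h1 : t ^ 2 / 4 ≤ Real.cosh t := by
    rw [Real.cosh_eq]
    linarith [Real.quadratic_le_exp_of_nonneg ht, Real.exp_pos (-t)]
  have h2 : a * (t ^ 2 / 4) ≤ a * Real.cosh t := mul_le_mul_of_nonneg_left h1 ha.le
  have h3 : (b + 1) * t ≤ (b + 1) ^ 2 / a + a * (t ^ 2 / 4) := by
    have h4 : (b + 1) ^ 2 / a + a * (t ^ 2 / 4) - (b + 1) * t
        = (b + 1 - a * t / 2) ^ 2 / a := by
      field_simp
      ring
    have h5 : 0 ≤ (b + 1 - a * t / 2) ^ 2 / a := by positivity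
    linarith
  linarith

theorem integrableOn_exp_neg_mul_cosh_mul_exp {a : ℝ} (ha : 0 < a) (b : ℝ) :
    IntegrableOn (fun t : ℝ => Real.exp (-a * Real.cosh t) * Real.exp (b * t))
      (Set.Ioi 0) := by
  refine Integrable.mono' ((integrableOn_exp_neg_Ioi 0).const_mul (Real.exp ((b + 1) ^ 2 / a)))
    (by fun_prop) ?_
  refine (ae_restrict_mem measurableSet_Ioi).mono fun t ht => ?_
  rw [Real.norm_of_nonneg (by positivity)]
  exact exp_neg_mul_cosh_mul_exp_le ha b (le_of_lt ht)

theorem norm_cosh_mul_le (μ : ℂ) (t : ℝ) :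
    ‖Complex.cosh (μ * t)‖ ≤ Real.cosh (μ.re * t) := by
  rw [Complex.cosh, Real.cosh_eq, norm_div, Complex.norm_two]
  gcongr
  refine (norm_add_le _ _).trans (le_of_eq ?_)
  simp [Complex.norm_exp]

/-- The integral defining `besselK` for real arguments. -/
noncomputable def besselKReal (σ x : ℝ) : ℝ :=
  ∫ t in Set.Ioi (0:ℝ), Real.exp (-x * Real.cosh t) * Real.cosh (σ * t)

theorem besselK_ofReal (σ x : ℝ) : besselK σ x = besselKReal σ x := by
  rw [besselK, besselKReal, ← integral_complex_ofReal]
  simp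

theorem besselKReal_nonneg (σ x : ℝ) : 0 ≤ besselKReal σ x :=
  integral_nonneg fun _ => mul_nonneg (Real.exp_pos _).le (Real.cosh_pos _).le

theorem integrableOn_exp_neg_mul_cosh_mul_cosh {a : ℝ} (ha : 0 < a) (b : ℝ) :
    IntegrableOn (fun t : ℝ => Real.exp (-a * Real.cosh t) * Real.cosh (b * t))
      (Set.Ioi 0) := by
  have h := ((integrableOn_exp_neg_mul_cosh_mul_exp ha b).add
    (integrableOn_exp_neg_mul_cosh_mul_exp ha (-b))).div_const 2
  refine IntegrableOn.congr_fun h (fun t _ => ?_) measurableSet_Ioi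
  simp only [Pi.add_apply]
  rw [Real.cosh_eq (b * t), neg_mul b t]
  ring

theorem norm_besselK_integrand_le (μ : ℂ) {x : ℝ} {z : ℂ} (hz : x ≤ z.re) (t : ℝ) :
    ‖Complex.exp (-z * Real.cosh t) * Complex.cosh (μ * t)‖
      ≤ Real.exp (-x * Real.cosh t) * Real.cosh (μ.re * t) := by
  rw [norm_mul]
  refine mul_le_mul ?_ (norm_cosh_mul_le μ t) (norm_nonneg _) (Real.exp_pos _).le
  rw [Complex.norm_exp, Real.exp_le_exp, re_mul_ofReal, neg_re]
  exact mul_le_mul_of_nonneg_right (neg_le_neg hz) (Real.cosh_pos t).le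

theorem norm_besselK_le (μ : ℂ) {x : ℝ} (hx : 0 < x) {z : ℂ} (hz : x ≤ z.re) :
    ‖besselK μ z‖ ≤ besselKReal μ.re x :=
  norm_integral_le_of_norm_le (integrableOn_exp_neg_mul_cosh_mul_cosh hx μ.re)
    (Filter.Eventually.of_forall fun t => norm_besselK_integrand_le μ hz t)

theorem integrableOn_besselK (μ : ℂ) {z : ℂ} (hz : 0 < z.re) :
    IntegrableOn (fun t : ℝ => Complex.exp (-z * Real.cosh t) * Complex.cosh (μ * t))
      (Set.Ioi 0) :=
  Integrable.mono' (integrableOn_exp_neg_mul_cosh_mul_cosh hz μ.re) (by fun_prop)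
    (Filter.Eventually.of_forall fun t => norm_besselK_integrand_le μ le_rfl t)

theorem differentiableAt_besselK (μ : ℂ) {z : ℂ} (hz : 0 < z.re) :
    DifferentiableAt ℂ (besselK μ) z := by
  have hs : {w : ℂ | z.re / 2 < w.re} ∈ nhds z :=
    (isOpen_lt continuous_const continuous_re).mem_nhds (show z.re / 2 < z.re by linarith)
  have hb : IntegrableOn (fun t : ℝ =>
      Real.cosh t * (Real.exp (-(z.re / 2) * Real.cosh t) * Real.cosh (μ.re * t)))
      (Set.Ioi 0) := by
    have h := ((integrableOn_exp_neg_mul_cosh_mul_cosh (half_pos hz) (μ.re + 1)).add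
      (integrableOn_exp_neg_mul_cosh_mul_cosh (half_pos hz) (μ.re - 1))).div_const 2
    refine IntegrableOn.congr_fun h (fun t _ => ?_) measurableSet_Ioi
    simp only [Pi.add_apply]
    rw [add_mul, sub_mul, one_mul, Real.cosh_add, Real.cosh_sub]
    ring
  refine (hasDerivAt_integral_of_dominated_loc_of_deriv_le
    (F := fun w (t : ℝ) => Complex.exp (-w * Real.cosh t) * Complex.cosh (μ * t))
    (F' := fun w (t : ℝ) =>
      -(Real.cosh t : ℂ) * (Complex.exp (-w * Real.cosh t) * Complex.cosh (μ * t)))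
    hs (Filter.Eventually.of_forall fun w => by fun_prop) (integrableOn_besselK μ hz)
    (by fun_prop) (Filter.Eventually.of_forall fun t w hw => ?_) hb
    (Filter.Eventually.of_forall fun t w _ => ?_)).2.differentiableAt
  · rw [norm_mul, norm_neg, norm_real, Real.norm_of_nonneg (Real.cosh_pos t).le]
    exact mul_le_mul_of_nonneg_left (norm_besselK_integrand_le μ (le_of_lt hw) t)
      (Real.cosh_pos t).le
  · have h := (((hasDerivAt_id w).neg.mul_const (Real.cosh t : ℂ)).cexp).mul_const
      (Complex.cosh (μ * t))
    convert! h using 1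
    simp
    ring

theorem integral_exp_mul_exp_neg_mul_cosh (μ : ℂ) {x : ℝ} (hx : 0 < x) :
    ∫ t : ℝ, Complex.exp (μ * t) * Complex.exp (-x * Real.cosh t) = 2 * besselK μ x := by
  set F : ℂ → ℝ → ℂ := fun μ t => Complex.exp (μ * t) * Complex.exp (-x * Real.cosh t) with hF
  have hi : ∀ μ : ℂ, IntegrableOn (F μ) (Set.Ioi 0) := fun μ => by
    refine Integrable.mono' (integrableOn_exp_neg_mul_cosh_mul_exp hx μ.re) (by fun_prop)
      (Filter.Eventually.of_forall fun t => ?_)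
    rw [hF, norm_mul, mul_comm, Complex.norm_exp, Complex.norm_exp, ← ofReal_neg,
      ← ofReal_mul, ofReal_re, re_mul_ofReal]
  have hneg : ∀ t, F μ (-t) = F (-μ) t := fun t => by simp [hF]
  have hi2 : IntegrableOn (F μ) (Set.Iic 0) := by
    have h := (Measure.measurePreserving_neg (volume : Measure ℝ)).integrableOn_comp_preimage
      (Homeomorph.neg ℝ).measurableEmbedding (f := F μ) (s := Set.Iio 0)
    have h2 : (fun t : ℝ => -t) ⁻¹' Set.Iio 0 = Set.Ioi 0 := by ext; simp
    rw [integrableOn_Iic_iff_integrableOn_Iio]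
    refine h.mp ?_
    change IntegrableOn _ ((fun t : ℝ => -t) ⁻¹' Set.Iio 0)
    rw [h2]
    exact (hi (-μ)).congr_fun (fun t _ => (hneg t).symm) measurableSet_Ioi
  rw [← intervalIntegral.integral_Iic_add_Ioi hi2 (hi μ)]
  have h1 : ∫ t in Set.Iic (0:ℝ), F μ t = ∫ t in Set.Ioi (0:ℝ), F (-μ) t := by
    have h := integral_comp_neg_Ioi (0:ℝ) (F μ)
    rw [neg_zero] at h
    rw [← h]
    simp only [hneg]
  rw [h1, ← integral_add (hi (-μ)) (hi μ), besselK, ← integral_const_mul]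
  refine integral_congr_ae (Filter.Eventually.of_forall fun t => ?_)
  simp only [hF, Complex.cosh]
  push_cast
  ring_nf

theorem integral_cpow_mul_exp_neg_add_div (μ : ℂ) {q c : ℝ} (hq : 0 < q) (hc : 0 < c) :
    ∫ x in Set.Ioi (0:ℝ), (x : ℂ) ^ (μ - 1) * Complex.exp (-(q / c * x + q * c / x))
      = 2 * (c : ℂ) ^ μ * besselK μ (2 * q) := by
  have himg : (fun t : ℝ => c * Real.exp t) '' Set.univ = Set.Ioi 0 := by
    ext x
    simp only [Set.image_univ, Set.mem_range, Set.mem_Ioi]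
    constructor
    · rintro ⟨t, rfl⟩
      positivity
    · intro hx
      refine ⟨Real.log (x / c), ?_⟩
      rw [Real.exp_log (div_pos hx hc)]
      field_simp
  have hinj : Set.InjOn (fun t : ℝ => c * Real.exp t) Set.univ := fun s _ t _ h =>
    Real.exp_injective (mul_left_cancel₀ hc.ne' h)
  have h := integral_image_eq_integral_abs_deriv_smul MeasurableSet.univ
    (fun t _ => ((Real.hasDerivAt_exp t).const_mul c).hasDerivWithinAt) hinj
    (fun x : ℝ => (x : ℂ) ^ (μ - 1) * Complex.exp (-(q / c * x + q * c / x)))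
  rw [himg] at h
  have h2 := integral_exp_mul_exp_neg_mul_cosh μ (x := 2 * q) (by positivity)
  push_cast at h2
  rw [h, Measure.restrict_univ, mul_assoc, mul_left_comm, ← h2, ← integral_const_mul]
  refine integral_congr_ae (Filter.Eventually.of_forall fun t => ?_)
  have hpos : 0 < c * Real.exp t := by positivity
  have hne : ((c * Real.exp t : ℝ) : ℂ) ≠ 0 := ofReal_ne_zero.mpr hpos.ne'
  have hc' : (c : ℂ) ≠ 0 := ofReal_ne_zero.mpr hc.ne'
  have h3 : ((c * Real.exp t : ℝ) : ℂ) ^ μ = (c : ℂ) ^ μ * Complex.exp (μ * t) := by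
    rw [ofReal_mul, mul_cpow_ofReal_nonneg hc.le (Real.exp_pos t).le,
      cpow_def_of_ne_zero (ofReal_ne_zero.mpr (Real.exp_pos t).ne'), ← ofReal_log
      (Real.exp_pos t).le, Real.log_exp, mul_comm (t : ℂ)]
  have h4 : -((q : ℂ) / c * (c * Real.exp t : ℝ) + q * c / (c * Real.exp t : ℝ))
      = -(2 * q) * Complex.cosh t := by
    rw [Complex.cosh]
    have := Complex.exp_ne_zero t
    push_cast
    rw [Complex.exp_neg]
    field_simp
  simp only [abs_of_pos hpos, real_smul]
  rw [h4, cpow_sub _ _ hne, cpow_one, h3]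
  field_simp

/-- The Mellin-type integrand whose integral produces a Bessel term. -/
noncomputable def besselTermIntegrand (k : ℕ) (μ : ℂ) (β : ℝ) (n : ℕ) (x : ℝ) : ℂ :=
  sqRep k n * ((x : ℂ) ^ (μ - 1) * Complex.exp (-(Real.pi * β * x + Real.pi * n / x)))

/-- The Mellin-type integrand whose integral produces a term of the dual Dirichlet series. -/
noncomputable def powTermIntegrand (k : ℕ) (μ : ℂ) (β : ℝ) (n : ℕ) (x : ℝ) : ℂ :=
  sqRep k n * ((x : ℂ) ^ (μ + (k : ℂ) / 2 - 1)
    * Complex.exp (-((Real.pi * (β + n) : ℝ) * x)))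

theorem besselTermIntegrand_eq (k : ℕ) (μ : ℂ) (β : ℝ) (n : ℕ) (x : ℝ) :
    besselTermIntegrand k μ β n x = (x : ℂ) ^ (μ - 1) * Complex.exp (-(Real.pi * β * x))
      * ((sqRep k n * Real.exp (-Real.pi * n / x) : ℝ) : ℂ) := by
  rw [besselTermIntegrand, neg_add, Complex.exp_add]
  push_cast
  ring_nf

theorem powTermIntegrand_eq (k : ℕ) (μ : ℂ) (β : ℝ) (n : ℕ) {x : ℝ} (hx : 0 < x) :
    powTermIntegrand k μ β n x = (x : ℂ) ^ (μ - 1) * Complex.exp (-(Real.pi * β * x))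
      * (((x ^ ((k : ℝ) / 2) : ℝ) : ℂ)
        * ((sqRep k n * Real.exp (-Real.pi * x * n) : ℝ) : ℂ)) := by
  have h1 : -(((Real.pi * (β + n) : ℝ) : ℂ) * x)
      = -(Real.pi * β * x) + -Real.pi * x * n := by
    push_cast
    ring
  rw [powTermIntegrand, h1, Complex.exp_add, ofReal_cpow hx.le,
    show μ + (k : ℂ) / 2 - 1 = (μ - 1) + (k : ℂ) / 2 by ring,
    cpow_add _ _ (ofReal_ne_zero.mpr hx.ne')]
  push_cast
  ring

theorem hasSum_besselTermIntegrand (k : ℕ) (μ : ℂ) (β : ℝ) {x : ℝ} (hx : 0 < x) :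
    HasSum (fun n => besselTermIntegrand k μ β n x) (∑' n, powTermIntegrand k μ β n x) := by
  simp only [besselTermIntegrand_eq, powTermIntegrand_eq _ _ _ _ hx]
  rw [tsum_mul_left, tsum_mul_left, ← ofReal_tsum]
  have h := hasSum_ofReal.mpr (hasSum_sqRep_mul_exp_inv k hx)
  rw [ofReal_mul (x ^ ((k : ℝ) / 2))] at h
  exact h.mul_left _

theorem tsum_enorm_besselTermIntegrand (k : ℕ) (μ : ℂ) (β : ℝ) {x : ℝ} (hx : 0 < x) :
    ∑' n, ‖besselTermIntegrand k μ β n x‖ₑ = ∑' n, ‖powTermIntegrand k μ β n x‖ₑ := by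
  simp only [besselTermIntegrand_eq, powTermIntegrand_eq _ _ _ _ hx, enorm_mul]
  rw [ENNReal.tsum_mul_left, ENNReal.tsum_mul_left, ENNReal.tsum_mul_left]
  have hpos : ∀ y : ℝ, 0 ≤ y → ‖(y : ℂ)‖ₑ = ENNReal.ofReal y := fun y hy => by
    rw [← ofReal_norm, norm_real, Real.norm_of_nonneg hy]
  have h1 := hasSum_sqRep_mul_exp_inv k hx
  have h2 := hasSum_sqRep_mul_exp k hx
  rw [tsum_congr fun n => hpos (sqRep k n * Real.exp (-Real.pi * n / x)) (by positivity),
    tsum_congr fun n => hpos (sqRep k n * Real.exp (-Real.pi * x * n)) (by positivity),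
    hpos _ (by positivity),
    ← ENNReal.ofReal_tsum_of_nonneg (fun n => by positivity) h1.summable,
    ← ENNReal.ofReal_tsum_of_nonneg (fun n => by positivity) h2.summable,
    ← ENNReal.ofReal_mul (by positivity), h1.tsum_eq]

theorem aestronglyMeasurable_besselTermIntegrand (k : ℕ) (μ : ℂ) (β : ℝ) (n : ℕ) :
    AEStronglyMeasurable (besselTermIntegrand k μ β n) (volume.restrict (Set.Ioi 0)) := by
  unfold besselTermIntegrand
  exact Measurable.aestronglyMeasurable (by fun_prop)

theorem aestronglyMeasurable_powTermIntegrand (k : ℕ) (μ : ℂ) (β : ℝ) (n : ℕ) :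
    AEStronglyMeasurable (powTermIntegrand k μ β n) (volume.restrict (Set.Ioi 0)) := by
  unfold powTermIntegrand
  exact Measurable.aestronglyMeasurable (by fun_prop)

theorem lintegral_enorm_powTermIntegrand {k : ℕ} {μ : ℂ} (hμ : 0 < μ.re) {β : ℝ} (hβ : 0 < β)
    (n : ℕ) :
    ∫⁻ x in Set.Ioi (0:ℝ), ‖powTermIntegrand k μ β n x‖ₑ
      = ENNReal.ofReal (sqRep k n * ((1 / (Real.pi * (β + n))) ^ (μ.re + k / 2)
          * Real.Gamma (μ.re + k / 2))) := by
  have hr : 0 < Real.pi * (β + n) := by positivity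
  have hs : 0 < μ.re + (k : ℝ) / 2 := by positivity
  have hint := Real.integral_rpow_mul_exp_neg_mul_Ioi hs hr
  have hne : (1 / (Real.pi * (β + n))) ^ (μ.re + (k : ℝ) / 2)
      * Real.Gamma (μ.re + (k : ℝ) / 2) ≠ 0 :=
    (mul_pos (by positivity) (Real.Gamma_pos_of_pos hs)).ne'
  have hi : IntegrableOn (fun x : ℝ => x ^ (μ.re + (k : ℝ) / 2 - 1)
      * Real.exp (-(Real.pi * (β + n) * x))) (Set.Ioi 0) := by
    by_contra h
    exact hne (hint.symm.trans (integral_undef h))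
  rw [← hint, ← integral_const_mul,
    ofReal_integral_eq_lintegral_ofReal (Integrable.const_mul hi _)
      ((ae_restrict_mem measurableSet_Ioi).mono fun x hx => by
        have : (0:ℝ) < x := hx
        positivity)]
  refine setLIntegral_congr_fun measurableSet_Ioi fun x hx => ?_
  rw [← ofReal_norm, powTermIntegrand, norm_mul, norm_mul, norm_cpow_eq_rpow_re_of_pos hx,
    Complex.norm_exp, norm_natCast]
  congr 4
  · simp
  · rw [← ofReal_mul, ← ofReal_neg, ofReal_re]

theorem one_div_pi_mul_add_rpow_le {β s : ℝ} (hβ : 0 < β) (hs : 0 ≤ s) (n : ℕ) :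
    (1 / (Real.pi * (β + n))) ^ s
      ≤ (Real.pi * min β 1) ^ (-s) * (1 + (n : ℝ)) ^ (-s) := by
  have hm : 0 < min β 1 := lt_min hβ one_pos
  have h1 : min β 1 * (1 + (n : ℝ)) ≤ β + n := by
    have := mul_le_mul_of_nonneg_right (min_le_right β 1) (Nat.cast_nonneg (α := ℝ) n)
    linarith [min_le_left β 1]
  rw [one_div, Real.inv_rpow (by positivity), ← Real.rpow_neg (by positivity),
    ← Real.mul_rpow (by positivity) (by positivity)]
  refine Real.rpow_le_rpow_of_nonpos (by positivity) ?_ (by linarith)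
  rw [mul_assoc]
  exact mul_le_mul_of_nonneg_left h1 Real.pi_pos.le

theorem tsum_lintegral_enorm_powTermIntegrand_ne_top {k : ℕ} (hk : 0 < k) {μ : ℂ}
    (hμ : 0 < μ.re) {β : ℝ} (hβ : 0 < β) :
    ∑' n, ∫⁻ x in Set.Ioi (0:ℝ), ‖powTermIntegrand k μ β n x‖ₑ ≠ ⊤ := by
  simp only [lintegral_enorm_powTermIntegrand hμ hβ]
  have hs : 0 < μ.re + (k : ℝ) / 2 := by positivity
  have hΓ := Real.Gamma_pos_of_pos hs
  refine Summable.tsum_ofReal_ne_top ?_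
  refine Summable.of_nonneg_of_le (fun n => by positivity) (fun n => ?_)
    ((summable_sqRep_mul_rpow hk (s := μ.re + (k : ℝ) / 2) (by linarith)).mul_left
      ((Real.pi * min β 1) ^ (-(μ.re + (k : ℝ) / 2)) * Real.Gamma (μ.re + (k : ℝ) / 2)))
  calc _ ≤ (sqRep k n : ℝ) * ((Real.pi * min β 1) ^ (-(μ.re + (k : ℝ) / 2))
        * (1 + (n : ℝ)) ^ (-(μ.re + (k : ℝ) / 2)) * Real.Gamma (μ.re + (k : ℝ) / 2)) := by
        gcongr
        exact one_div_pi_mul_add_rpow_le hβ hs.le n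
    _ = _ := by ring

theorem tsum_lintegral_enorm_besselTermIntegrand_ne_top {k : ℕ} (hk : 0 < k) {μ : ℂ}
    (hμ : 0 < μ.re) {β : ℝ} (hβ : 0 < β) :
    ∑' n, ∫⁻ x in Set.Ioi (0:ℝ), ‖besselTermIntegrand k μ β n x‖ₑ ≠ ⊤ := by
  have h := tsum_lintegral_enorm_powTermIntegrand_ne_top hk hμ hβ
  rw [← lintegral_tsum fun n => (aestronglyMeasurable_powTermIntegrand k μ β n).enorm] at h
  rw [← lintegral_tsum fun n => (aestronglyMeasurable_besselTermIntegrand k μ β n).enorm,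
    setLIntegral_congr_fun measurableSet_Ioi
      fun x hx => tsum_enorm_besselTermIntegrand k μ β hx]
  exact h

theorem summable_integral_besselTermIntegrand {k : ℕ} (hk : 0 < k) {μ : ℂ}
    (hμ : 0 < μ.re) {β : ℝ} (hβ : 0 < β) :
    Summable fun n => ∫ x in Set.Ioi (0:ℝ), besselTermIntegrand k μ β n x := by
  have h := ENNReal.summable_toReal (ne_top_of_le_ne_top
    (tsum_lintegral_enorm_besselTermIntegrand_ne_top hk hμ hβ)
    (ENNReal.tsum_le_tsum fun n => enorm_integral_le_lintegral_enorm
      (μ := volume.restrict (Set.Ioi (0:ℝ))) (besselTermIntegrand k μ β n)))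
  simp only [toReal_enorm] at h
  exact h.of_norm

theorem tsum_integral_besselTermIntegrand {k : ℕ} (hk : 0 < k) {μ : ℂ}
    (hμ : 0 < μ.re) {β : ℝ} (hβ : 0 < β) :
    ∑' n, ∫ x in Set.Ioi (0:ℝ), besselTermIntegrand k μ β n x
      = ∑' n, ∫ x in Set.Ioi (0:ℝ), powTermIntegrand k μ β n x := by
  rw [← integral_tsum (aestronglyMeasurable_besselTermIntegrand k μ β)
      (tsum_lintegral_enorm_besselTermIntegrand_ne_top hk hμ hβ),
    ← integral_tsum (aestronglyMeasurable_powTermIntegrand k μ β)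
      (tsum_lintegral_enorm_powTermIntegrand_ne_top hk hμ hβ)]
  exact setIntegral_congr_fun measurableSet_Ioi
    fun x hx => (hasSum_besselTermIntegrand k μ β hx).tsum_eq

theorem one_div_pi_mul_cpow {b : ℝ} (hb : 0 < b) (w : ℂ) :
    (1 / ((Real.pi * b : ℝ) : ℂ)) ^ w = 1 / ((Real.pi : ℂ) ^ w * (b : ℂ) ^ w) := by
  have hb' : 0 < Real.pi * b := by positivity
  rw [one_div, inv_cpow _ _ (by rw [arg_ofReal_of_nonneg hb'.le]; exact Real.pi_pos.ne),
    ofReal_mul, mul_cpow_ofReal_nonneg Real.pi_pos.le hb.le, one_div]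

theorem integral_powTermIntegrand {k : ℕ} {μ : ℂ} (hμ : 0 < μ.re) {β : ℝ} (hβ : 0 < β)
    (n : ℕ) :
    ∫ x in Set.Ioi (0:ℝ), powTermIntegrand k μ β n x
      = Complex.Gamma (μ + (k : ℂ) / 2) / (Real.pi : ℂ) ^ (μ + (k : ℂ) / 2)
        * (sqRep k n / ((β : ℂ) + n) ^ (μ + (k : ℂ) / 2)) := by
  have hs : 0 < (μ + (k : ℂ) / 2).re := by
    have : ((k : ℂ) / 2).re = (k : ℝ) / 2 := by simp
    rw [add_re, this]
    positivity
  unfold powTermIntegrand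
  rw [integral_const_mul, integral_cpow_mul_exp_neg_mul_Ioi hs (by positivity),
    one_div_pi_mul_cpow (by positivity)]
  push_cast
  ring

theorem integral_besselTermIntegrand_zero {k : ℕ} {μ : ℂ} (hμ : 0 < μ.re) {β : ℝ}
    (hβ : 0 < β) :
    ∫ x in Set.Ioi (0:ℝ), besselTermIntegrand k μ β 0 x
      = Complex.Gamma μ / ((Real.pi : ℂ) ^ μ * (β : ℂ) ^ μ) := by
  have h := integral_cpow_mul_exp_neg_mul_Ioi hμ (show 0 < Real.pi * β by positivity)
  rw [one_div_pi_mul_cpow hβ] at h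
  simp only [besselTermIntegrand, sqRep_zero, Nat.cast_zero, mul_zero, zero_div, add_zero,
    Nat.cast_one, one_mul]
  push_cast at h
  rw [h]
  ring

theorem ofReal_sqrt_cpow {a : ℝ} (ha : 0 < a) (μ : ℂ) :
    ((√a : ℝ) : ℂ) ^ μ = (a : ℂ) ^ (μ / 2) := by
  rw [cpow_def_of_ne_zero (ofReal_ne_zero.mpr (Real.sqrt_pos.mpr ha).ne'),
    cpow_def_of_ne_zero (ofReal_ne_zero.mpr ha.ne'), ← ofReal_log (Real.sqrt_nonneg a),
    ← ofReal_log ha.le, Real.log_sqrt ha.le]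
  push_cast
  ring_nf

theorem ofReal_cpow_half {a : ℝ} (ha : 0 ≤ a) : (a : ℂ) ^ ((1:ℂ) / 2) = (√a : ℝ) := by
  rw [Real.sqrt_eq_rpow, ofReal_cpow ha]
  norm_num

theorem integral_besselTermIntegrand_of_pos {k : ℕ} (μ : ℂ) {β : ℝ} (hβ : 0 < β) {n : ℕ}
    (hn : 0 < n) :
    (β : ℂ) ^ (μ / 2) / 2 * ∫ x in Set.Ioi (0:ℝ), besselTermIntegrand k μ β n x
      = sqRep k n * (n : ℂ) ^ (μ / 2)
        * besselK μ (2 * Real.pi * ((n : ℂ) * β) ^ ((1:ℂ) / 2)) := by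
  have hn' : (0:ℝ) < n := by exact_mod_cast hn
  have hsn : 0 < √(n : ℝ) := Real.sqrt_pos.mpr hn'
  have hsβ : 0 < √β := Real.sqrt_pos.mpr hβ
  have hq : 0 < Real.pi * (√n * √β) := by positivity
  have hc : 0 < √n / √β := by positivity
  have h := integral_cpow_mul_exp_neg_add_div μ hq hc
  have h1 : ((Real.pi * (√n * √β) : ℝ) : ℂ) / (√n / √β : ℝ) = Real.pi * β := by
    rw [← ofReal_div, ← ofReal_mul]
    congr 1
    field_simp
    rw [Real.sq_sqrt hβ.le]
  have h2 : ((Real.pi * (√n * √β) : ℝ) : ℂ) * (√n / √β : ℝ) = Real.pi * n := by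
    rw [← ofReal_mul, ← ofReal_natCast, ← ofReal_mul]
    congr 1
    field_simp
    rw [Real.sq_sqrt hn'.le]
  have h3 : ((√n / √β : ℝ) : ℂ) ^ μ * (β : ℂ) ^ (μ / 2) = (n : ℂ) ^ (μ / 2) := by
    rw [← ofReal_sqrt_cpow hβ, ← mul_cpow_ofReal_nonneg hc.le hsβ.le, ← ofReal_mul,
      div_mul_cancel₀ _ hsβ.ne', ofReal_sqrt_cpow hn', ofReal_natCast]
  have h4 : ((n : ℂ) * β) ^ ((1:ℂ) / 2) = ((√n * √β : ℝ) : ℂ) := by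
    rw [← ofReal_natCast, ← ofReal_mul, ofReal_cpow_half (by positivity),
      Real.sqrt_mul hn'.le]
  rw [h1, h2] at h
  unfold besselTermIntegrand
  rw [integral_const_mul, h, h4, ← h3]
  push_cast
  ring_nf

theorem summable_bessel_of_pos {k : ℕ} (hk : 0 < k) {μ : ℂ} (hμ : 0 < μ.re) {β : ℝ}
    (hβ : 0 < β) :
    Summable fun n : ℕ => (sqRep k (n+1) : ℂ) * ((n+1 : ℕ) : ℂ) ^ (μ / 2)
      * besselK μ (2 * Real.pi * (((n+1 : ℕ) : ℂ) * β) ^ ((1:ℂ)/2)) :=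
  (((summable_nat_add_iff 1).mpr (summable_integral_besselTermIntegrand hk hμ hβ)).mul_left
    ((β : ℂ) ^ (μ / 2) / 2)).congr
    fun n => integral_besselTermIntegrand_of_pos μ hβ n.succ_pos

theorem popov_identity_of_pos {k : ℕ} (hk : 0 < k) {μ : ℂ} (hμ : 0 < μ.re) {β : ℝ}
    (hβ : 0 < β) :
    Complex.Gamma μ / (2 * (Real.pi : ℂ) ^ μ * (β : ℂ) ^ (μ / 2))
      + ∑' n : ℕ, (sqRep k (n+1) : ℂ) * ((n+1 : ℕ) : ℂ) ^ (μ / 2)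
          * besselK μ (2 * Real.pi * (((n+1 : ℕ) : ℂ) * β) ^ ((1:ℂ)/2))
      = ((β : ℂ) ^ (μ / 2) * Complex.Gamma (μ + (k:ℂ)/2)
          / (2 * (Real.pi : ℂ) ^ (μ + (k:ℂ)/2)))
        * ∑' n : ℕ, (sqRep k n : ℂ) / ((β : ℂ) + n) ^ (μ + (k:ℂ)/2) := by
  have hβ' : (β : ℂ) ≠ 0 := ofReal_ne_zero.mpr hβ.ne'
  have h1 : Complex.Gamma μ / (2 * (Real.pi : ℂ) ^ μ * (β : ℂ) ^ (μ / 2))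
      = (β : ℂ) ^ (μ / 2) / 2 * ∫ x in Set.Ioi (0:ℝ), besselTermIntegrand k μ β 0 x := by
    have h2 : (β : ℂ) ^ μ = (β : ℂ) ^ (μ / 2) * (β : ℂ) ^ (μ / 2) := by
      rw [← cpow_add _ _ hβ', add_halves]
    have h3 : (β : ℂ) ^ (μ / 2) ≠ 0 := by simp [cpow_eq_zero_iff, hβ']
    have h4 : (Real.pi : ℂ) ^ μ ≠ 0 := by simp [cpow_eq_zero_iff, Real.pi_ne_zero]
    rw [integral_besselTermIntegrand_zero hμ hβ, h2]
    field_simp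
  rw [h1, ← tsum_congr fun n => integral_besselTermIntegrand_of_pos μ hβ (Nat.succ_pos n),
    tsum_mul_left, ← mul_add,
    ← (summable_integral_besselTermIntegrand hk hμ hβ).tsum_eq_zero_add,
    tsum_integral_besselTermIntegrand hk hμ hβ,
    tsum_congr fun n => integral_powTermIntegrand hμ hβ n, tsum_mul_left]
  ring

theorem mem_slitPlane_of_re_cpow_half_pos {β : ℂ} (hβ : 0 < (β ^ ((1:ℂ) / 2)).re) :
    β ∈ slitPlane := by
  rw [mem_slitPlane_iff_arg]
  constructor
  · intro h
    rw [show (1:ℂ) / 2 = ((1 / 2 : ℝ) : ℂ) by push_cast; rfl, cpow_ofReal_re, h,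
      mul_one_div, Real.cos_pi_div_two, mul_zero] at hβ
    exact lt_irrefl _ hβ
  · rintro rfl
    simp at hβ

theorem re_cpow_half_pos {β : ℂ} (hβ : β ∈ slitPlane) : 0 < (β ^ ((1:ℂ) / 2)).re := by
  rw [show (1:ℂ) / 2 = ((1 / 2 : ℝ) : ℂ) by push_cast; rfl, cpow_ofReal_re]
  obtain ⟨h1, h2⟩ := mem_slitPlane_iff_arg.mp hβ
  have h3 : arg β < Real.pi := lt_of_le_of_ne (arg_le_pi β) h1
  refine mul_pos (Real.rpow_pos_of_pos (norm_pos_iff.mpr h2) _) (Real.cos_pos_of_mem_Ioo ⟨?_, ?_⟩)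
  · linarith [neg_pi_lt_arg β]
  · linarith

theorem natCast_mul_cpow_half (n : ℕ) (β : ℂ) :
    ((n : ℂ) * β) ^ ((1:ℂ) / 2) = (√(n : ℝ) : ℝ) * β ^ ((1:ℂ) / 2) := by
  rcases eq_or_ne β 0 with rfl | hβ
  · simp
  rcases n.eq_zero_or_pos with rfl | hn
  · simp
  have hn' : (0:ℝ) < n := by exact_mod_cast hn
  have hn0 : (n : ℂ) ≠ 0 := by exact_mod_cast hn.ne'
  rw [← ofReal_cpow_half hn'.le, ofReal_natCast, cpow_def_of_ne_zero (mul_ne_zero hn0 hβ),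
    cpow_def_of_ne_zero hn0, cpow_def_of_ne_zero hβ, ← Complex.exp_add, ← add_mul,
    ← ofReal_natCast, log_ofReal_mul hn' hβ, ofReal_log hn'.le]

theorem natCast_mul_mem_slitPlane {n : ℕ} (hn : 0 < n) {β : ℂ} (hβ : β ∈ slitPlane) :
    (n : ℂ) * β ∈ slitPlane := by
  have hn' : (0:ℝ) < n := by exact_mod_cast hn
  rw [mem_slitPlane_iff] at hβ ⊢
  rw [← ofReal_natCast, re_ofReal_mul, im_ofReal_mul]
  exact hβ.imp (mul_pos hn') (mul_ne_zero hn'.ne')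

theorem natCast_add_mem_slitPlane {β : ℂ} (hβ : β ∈ slitPlane) (n : ℕ) :
    β + n ∈ slitPlane := by
  rw [mem_slitPlane_iff] at hβ ⊢
  rw [add_re, add_im, natCast_re, natCast_im, add_zero]
  exact hβ.imp (fun h => by positivity) id

theorem norm_bessel_term_le {k : ℕ} (μ : ℂ) {δ : ℝ} (hδ : 0 < δ) {β : ℂ}
    (hβ : δ ≤ (β ^ ((1:ℂ) / 2)).re) (n : ℕ) :
    ‖(sqRep k (n+1) : ℂ) * ((n+1 : ℕ) : ℂ) ^ (μ / 2)
      * besselK μ (2 * Real.pi * (((n+1 : ℕ) : ℂ) * β) ^ ((1:ℂ)/2))‖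
    ≤ ‖(sqRep k (n+1) : ℂ) * ((n+1 : ℕ) : ℂ) ^ ((μ.re : ℂ) / 2)
      * besselK μ.re
        (2 * Real.pi * (((n+1 : ℕ) : ℂ) * ((δ ^ 2 : ℝ) : ℂ)) ^ ((1:ℂ)/2))‖ := by
  have hs : 0 < √((n+1 : ℕ) : ℝ) := Real.sqrt_pos.mpr (by positivity)
  have hx : 0 < 2 * Real.pi * (√((n+1 : ℕ) : ℝ) * δ) := by positivity
  rw [natCast_mul_cpow_half, natCast_mul_cpow_half, ofReal_cpow_half (sq_nonneg δ),
    Real.sqrt_sq hδ.le,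
    show (2 : ℂ) * Real.pi * ((√((n+1 : ℕ) : ℝ) : ℝ) * δ)
      = ((2 * Real.pi * (√((n+1 : ℕ) : ℝ) * δ) : ℝ) : ℂ) by push_cast; ring,
    besselK_ofReal, norm_mul, norm_mul, norm_mul, norm_mul, norm_real,
    Real.norm_of_nonneg (besselKReal_nonneg _ _),
    norm_natCast_cpow_of_pos n.succ_pos, norm_natCast_cpow_of_pos n.succ_pos]
  have hre : ((μ.re : ℂ) / 2).re = (μ / 2).re := by simp
  rw [hre]
  refine mul_le_mul_of_nonneg_left (norm_besselK_le μ hx ?_) (by positivity)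
  rw [show (2 : ℂ) * Real.pi * ((√((n+1 : ℕ) : ℝ) : ℝ) * β ^ ((1:ℂ) / 2))
      = ((2 * Real.pi * √((n+1 : ℕ) : ℝ) : ℝ) : ℂ) * β ^ ((1:ℂ) / 2) by push_cast; ring,
    re_ofReal_mul, ← mul_assoc]
  exact mul_le_mul_of_nonneg_left hβ (by positivity)

theorem summable_bessel {k : ℕ} (hk : 0 < k) {μ : ℂ} (hμ : 0 < μ.re) {β : ℂ}
    (hβ : β ∈ slitPlane) :
    Summable fun n : ℕ => (sqRep k (n+1) : ℂ) * ((n+1 : ℕ) : ℂ) ^ (μ / 2)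
      * besselK μ (2 * Real.pi * (((n+1 : ℕ) : ℂ) * β) ^ ((1:ℂ)/2)) :=
  have hδ := re_cpow_half_pos hβ
  Summable.of_norm_bounded
    (summable_bessel_of_pos hk (μ := (μ.re : ℂ)) (by simpa using hμ) (pow_pos hδ 2)).norm
    fun n => norm_bessel_term_le μ hδ le_rfl n

theorem continuousAt_re_cpow_half {β : ℂ} (hβ : β ∈ slitPlane) :
    ContinuousAt (fun z : ℂ => (z ^ ((1:ℂ) / 2)).re) β :=
  continuous_re.continuousAt.comp (continuousAt_cpow_const hβ)

theorem isOpen_slitPlane_inter_re_cpow_half (δ : ℝ) :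
    IsOpen {z : ℂ | z ∈ slitPlane ∧ δ < (z ^ ((1:ℂ) / 2)).re} := by
  rw [isOpen_iff_mem_nhds]
  rintro z ⟨h1, h2⟩
  exact Filter.inter_mem (isOpen_slitPlane.mem_nhds h1)
    ((continuousAt_re_cpow_half h1).eventually (lt_mem_nhds h2))

theorem differentiableOn_tsum_bessel {k : ℕ} (hk : 0 < k) {μ : ℂ} (hμ : 0 < μ.re) :
    DifferentiableOn ℂ (fun β : ℂ => ∑' n : ℕ, (sqRep k (n+1) : ℂ)
      * ((n+1 : ℕ) : ℂ) ^ (μ / 2)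
      * besselK μ (2 * Real.pi * (((n+1 : ℕ) : ℂ) * β) ^ ((1:ℂ)/2))) slitPlane := by
  intro β hβ
  refine DifferentiableAt.differentiableWithinAt ?_
  have hδ := half_pos (re_cpow_half_pos hβ)
  have hopen := isOpen_slitPlane_inter_re_cpow_half ((β ^ ((1:ℂ) / 2)).re / 2)
  refine (differentiableOn_tsum_of_summable_norm
    (summable_bessel_of_pos (k := k) hk (μ := (μ.re : ℂ)) (by simpa using hμ)
      (pow_pos hδ 2)).norm
    (fun n z hz => ?_) hopen
    fun n z hz => norm_bessel_term_le μ hδ hz.2.le n).differentiableAt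
      (hopen.mem_nhds ⟨hβ, by linarith⟩)
  have hz' := natCast_mul_mem_slitPlane n.succ_pos hz.1
  refine (DifferentiableAt.const_mul ?_ _).differentiableWithinAt
  refine (differentiableAt_besselK μ ?_).comp z
    (((differentiableAt_id.const_mul _).cpow_const hz').const_mul _)
  rw [← ofReal_ofNat, ← ofReal_mul, re_ofReal_mul]
  exact mul_pos (by positivity) (re_cpow_half_pos hz')

theorem sq_le_norm_add_natCast {δ : ℝ} (hδ : 0 ≤ δ) {β : ℂ}
    (hβ : δ ≤ (β ^ ((1:ℂ) / 2)).re) (n : ℕ) : δ ^ 2 ≤ ‖β + n‖ := by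
  set w := β ^ ((1:ℂ) / 2) with hw
  have hw2 : w ^ 2 = β := by
    rw [hw, one_div]
    exact cpow_nat_inv_pow β two_ne_zero
  have hs : ((√(n : ℝ) : ℝ) : ℂ) ^ 2 = n := by
    rw [← ofReal_pow, Real.sq_sqrt (Nat.cast_nonneg n), ofReal_natCast]
  have hf : β + n = (w + (√(n : ℝ) : ℝ) * I) * (w - (√(n : ℝ) : ℝ) * I) := by
    rw [← hw2, ← hs]
    linear_combination (((√(n : ℝ) : ℝ) : ℂ) ^ 2) * I_sq
  rw [hf, norm_mul, sq]
  refine mul_le_mul ?_ ?_ hδ (norm_nonneg _)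
  · refine le_trans ?_ (re_le_norm _)
    simpa using hβ
  · refine le_trans ?_ (re_le_norm _)
    simpa using hβ

theorem exists_mul_le_norm_add_natCast {δ R : ℝ} (hδ : 0 < δ) (hR : 0 < R) :
    ∃ c : ℝ, 0 < c ∧ ∀ β : ℂ, δ ≤ (β ^ ((1:ℂ) / 2)).re → ‖β‖ ≤ R → ∀ n : ℕ,
      c * (1 + n) ≤ ‖β + n‖ := by
  refine ⟨min (1 / 2) (δ ^ 2 / (2 + 2 * R)), by positivity, fun β h1 h2 n => ?_⟩
  rcases le_total (n : ℝ) (1 + 2 * R) with h | h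
  · calc _ ≤ δ ^ 2 / (2 + 2 * R) * (2 + 2 * R) :=
          mul_le_mul (min_le_right _ _) (by linarith) (by positivity) (by positivity)
      _ = δ ^ 2 := by field_simp
      _ ≤ _ := sq_le_norm_add_natCast hδ.le h1 n
  · have h3 : (n : ℝ) - R ≤ ‖β + n‖ := by
      have := norm_sub_le (β + n) β
      rw [add_sub_cancel_left, norm_natCast] at this
      linarith
    calc _ ≤ 1 / 2 * (1 + (n : ℝ)) :=
          mul_le_mul_of_nonneg_right (min_le_left _ _) (by positivity)
      _ ≤ _ := by linarith

theorem norm_div_cpow_le {c : ℝ} (hc : 0 < c) {w : ℂ} (hw : 0 ≤ w.re) {z : ℂ} {n : ℕ}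
    (hz : c * (1 + n) ≤ ‖z‖) (r : ℕ) :
    ‖(r : ℂ) / z ^ w‖
      ≤ c ^ (-w.re) * Real.exp (Real.pi * |w.im|) * (r * (1 + (n : ℝ)) ^ (-w.re)) := by
  have hz0 : 0 < ‖z‖ := lt_of_lt_of_le (by positivity) hz
  have h1 : ‖z ^ (-w)‖ ≤ ‖z‖ ^ (-w.re) * Real.exp (Real.pi * |w.im|) := by
    refine (norm_cpow_le z (-w)).trans ?_
    rw [neg_re, neg_im, div_eq_mul_inv, ← Real.exp_neg]
    refine mul_le_mul_of_nonneg_left (Real.exp_le_exp.mpr ?_) (by positivity)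
    calc _ ≤ |arg z * w.im| := by rw [mul_neg, neg_neg]; exact le_abs_self _
      _ = |arg z| * |w.im| := abs_mul _ _
      _ ≤ _ := mul_le_mul_of_nonneg_right (abs_arg_le_pi z) (abs_nonneg _)
  have h2 : ‖z‖ ^ (-w.re) ≤ c ^ (-w.re) * (1 + (n : ℝ)) ^ (-w.re) := by
    rw [← Real.mul_rpow hc.le (by positivity)]
    exact Real.rpow_le_rpow_of_nonpos (by positivity) hz (by linarith)
  rw [div_eq_mul_inv, ← cpow_neg, norm_mul, norm_natCast]
  calc _ ≤ (r : ℝ) * (c ^ (-w.re) * (1 + (n : ℝ)) ^ (-w.re)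
        * Real.exp (Real.pi * |w.im|)) := by
        gcongr
        exact h1.trans (by gcongr)
    _ = _ := by ring

theorem summable_sqRep_div_cpow {k : ℕ} (hk : 0 < k) {w : ℂ} (hw : (k : ℝ) / 2 < w.re)
    {β : ℂ} (hβ : β ∈ slitPlane) :
    Summable fun n : ℕ => (sqRep k n : ℂ) / (β + n) ^ w := by
  obtain ⟨c, hc, h⟩ := exists_mul_le_norm_add_natCast (re_cpow_half_pos hβ)
    (norm_pos_iff.mpr (slitPlane_ne_zero hβ))
  exact Summable.of_norm_bounded ((summable_sqRep_mul_rpow hk hw).mul_left _)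
    fun n => norm_div_cpow_le hc (le_trans (by positivity) hw.le) (h β le_rfl le_rfl n) _

theorem differentiableOn_tsum_sqRep_div_cpow {k : ℕ} (hk : 0 < k) {w : ℂ}
    (hw : (k : ℝ) / 2 < w.re) :
    DifferentiableOn ℂ (fun β : ℂ => ∑' n : ℕ, (sqRep k n : ℂ) / (β + n) ^ w)
      slitPlane := by
  intro β hβ
  refine DifferentiableAt.differentiableWithinAt ?_
  have hδ := half_pos (re_cpow_half_pos hβ)
  have hopen := (isOpen_slitPlane_inter_re_cpow_half ((β ^ ((1:ℂ) / 2)).re / 2)).inter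
    (isOpen_lt continuous_norm (continuous_const (y := ‖β‖ + 1)))
  obtain ⟨c, hc, h⟩ := exists_mul_le_norm_add_natCast (R := ‖β‖ + 1) hδ (by positivity)
  refine (differentiableOn_tsum_of_summable_norm
    ((summable_sqRep_mul_rpow hk hw).mul_left
      (c ^ (-w.re) * Real.exp (Real.pi * |w.im|)))
    (fun n z hz => ?_) hopen
    fun n z hz => norm_div_cpow_le hc (le_trans (by positivity) hw.le)
      (h z hz.1.2.le (le_of_lt hz.2) n) _).differentiableAt
      (hopen.mem_nhds ⟨⟨hβ, by linarith⟩, show ‖β‖ < ‖β‖ + 1 by linarith⟩)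
  have hz' := natCast_add_mem_slitPlane hz.1.1 n
  refine DifferentiableAt.differentiableWithinAt ?_
  refine (differentiableAt_const _).div ((differentiableAt_id.add_const _).cpow_const hz') ?_
  simp [cpow_eq_zero_iff, slitPlane_ne_zero hz']

theorem popov_identity_of_mem_slitPlane {k : ℕ} (hk : 0 < k) {μ : ℂ} (hμ : 0 < μ.re) {β : ℂ}
    (hβ : β ∈ slitPlane) :
    Complex.Gamma μ / (2 * (Real.pi : ℂ) ^ μ * β ^ (μ / 2))
      + ∑' n : ℕ, (sqRep k (n+1) : ℂ) * ((n+1 : ℕ) : ℂ) ^ (μ / 2)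
          * besselK μ (2 * Real.pi * (((n+1 : ℕ) : ℂ) * β) ^ ((1:ℂ)/2))
      = (β ^ (μ / 2) * Complex.Gamma (μ + (k:ℂ)/2)
          / (2 * (Real.pi : ℂ) ^ (μ + (k:ℂ)/2)))
        * ∑' n : ℕ, (sqRep k n : ℂ) / (β + n) ^ (μ + (k:ℂ)/2) := by
  have hw : (k : ℝ) / 2 < (μ + (k:ℂ)/2).re := by
    have : ((k : ℂ) / 2).re = (k : ℝ) / 2 := by simp
    rw [add_re, this]
    linarith
  have hpow : DifferentiableOn ℂ (fun β : ℂ => β ^ (μ / 2)) slitPlane := fun z hz =>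
    (differentiableAt_id.cpow_const hz).differentiableWithinAt
  have hπ : (Real.pi : ℂ) ^ μ ≠ 0 := by simp [cpow_eq_zero_iff, Real.pi_ne_zero]
  refine AnalyticOnNhd.eqOn_of_preconnected_of_frequently_eq (𝕜 := ℂ) (U := slitPlane) (z₀ := 1)
    (f := fun β : ℂ => Complex.Gamma μ / (2 * (Real.pi : ℂ) ^ μ * β ^ (μ / 2))
      + ∑' n : ℕ, (sqRep k (n+1) : ℂ) * ((n+1 : ℕ) : ℂ) ^ (μ / 2)
          * besselK μ (2 * Real.pi * (((n+1 : ℕ) : ℂ) * β) ^ ((1:ℂ)/2)))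
    (g := fun β : ℂ => (β ^ (μ / 2) * Complex.Gamma (μ + (k:ℂ)/2)
          / (2 * (Real.pi : ℂ) ^ (μ + (k:ℂ)/2)))
        * ∑' n : ℕ, (sqRep k n : ℂ) / (β + n) ^ (μ + (k:ℂ)/2))
    (DifferentiableOn.analyticOnNhd ?_ isOpen_slitPlane)
    (DifferentiableOn.analyticOnNhd ?_ isOpen_slitPlane)
    (starConvex_one_slitPlane.isPathConnected
      one_mem_slitPlane).isConnected.isPreconnected one_mem_slitPlane ?_ hβ
  · refine DifferentiableOn.add ?_ (differentiableOn_tsum_bessel hk hμ)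
    refine (differentiableOn_const _).div (hpow.const_mul _) fun z hz => ?_
    simp [cpow_eq_zero_iff, slitPlane_ne_zero hz, Real.pi_ne_zero]
  · exact ((hpow.mul_const _).div_const _).mul (differentiableOn_tsum_sqRep_div_cpow hk hw)
  · have htend : Tendsto (fun t : ℝ => (t : ℂ)) (nhdsWithin 1 {1}ᶜ) (nhdsWithin 1 {1}ᶜ) := by
      refine tendsto_nhdsWithin_iff.mpr ⟨?_, ?_⟩
      · have h := continuous_ofReal.tendsto (1:ℝ)
        rw [ofReal_one] at h
        exact h.mono_left nhdsWithin_le_nhds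
      · filter_upwards [self_mem_nhdsWithin] with t ht
        simpa using ht
    have hev : ∀ᶠ t : ℝ in nhdsWithin 1 {1}ᶜ, 0 < t :=
      nhdsWithin_le_nhds (lt_mem_nhds one_pos)
    exact htend.frequently (hev.mono fun t ht => popov_identity_of_pos hk hμ ht).frequently

/-- **Popov's identity.**  For a positive integer `k`, `Re ν > -1`, and `β ∈ ℂ` with
`Re √β > 0`,
`Γ(ν+1)/(2π^{ν+1}β^{(ν+1)/2}) + ∑_{n=1}^∞ r_k(n) n^{(ν+1)/2} K_{ν+1}(2π√(nβ))
  = (β^{(ν+1)/2} Γ(ν+1+k/2)/(2π^{k/2+ν+1})) ∑_{n=0}^∞ r_k(n)/(β+n)^{k/2+ν+1}`,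
both series converging absolutely; the term `Γ(ν+1)/(2π^{ν+1}β^{(ν+1)/2})` is the `n = 0`
term of the left-hand series interpreted as a limit. -/
theorem popov_identity (k : ℕ) (hk : 0 < k) (ν β : ℂ)
    (hν : -1 < ν.re) (hβ : 0 < (β ^ ((1:ℂ)/2)).re) :
    Summable (fun n : ℕ => (sqRep k (n+1) : ℂ) * ((n+1 : ℕ) : ℂ) ^ ((ν+1)/2)
      * besselK (ν+1) (2 * Real.pi * (((n+1 : ℕ) : ℂ) * β) ^ ((1:ℂ)/2))) ∧
    Summable (fun n : ℕ => (sqRep k n : ℂ) / (β + n) ^ ((k:ℂ)/2 + ν + 1)) ∧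
    Complex.Gamma (ν+1) / (2 * (Real.pi : ℂ) ^ (ν+1) * β ^ ((ν+1)/2))
      + ∑' n : ℕ, (sqRep k (n+1) : ℂ) * ((n+1 : ℕ) : ℂ) ^ ((ν+1)/2)
          * besselK (ν+1) (2 * Real.pi * (((n+1 : ℕ) : ℂ) * β) ^ ((1:ℂ)/2))
      = (β ^ ((ν+1)/2) * Complex.Gamma (ν + 1 + (k:ℂ)/2)
          / (2 * (Real.pi : ℂ) ^ ((k:ℂ)/2 + ν + 1)))
        * ∑' n : ℕ, (sqRep k n : ℂ) / (β + n) ^ ((k:ℂ)/2 + ν + 1) := by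
  have hμ : 0 < (ν + 1).re := by
    rw [add_re, one_re]
    linarith
  have hβ' := mem_slitPlane_of_re_cpow_half_pos hβ
  have hw : (k:ℂ) / 2 + ν + 1 = (ν + 1) + (k:ℂ) / 2 := by ring
  rw [hw]
  refine ⟨summable_bessel hk hμ hβ', summable_sqRep_div_cpow hk ?_ hβ',
    popov_identity_of_mem_slitPlane hk hμ hβ'⟩
  have : ((k : ℂ) / 2).re = (k : ℝ) / 2 := by simp
  rw [add_re, this]
  linarith
end

section
/- For every s ∈ ℂ with Re(s) > 0, ∑_{n=1}^∞ τ(n) e^{−s√n} = 2^{36} π^{23/2} Γ(25/2) ∑_{n=1}^∞ s·τ(n)/(s² + 16π²n)^{25/2}, both series converging absolutely (the complex power on the right is the principal branch). -/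
open MeasureTheory Filter Complex

section Tau

open ModularForm
open UpperHalfPlane hiding I
open scoped MatrixGroups Real

open Function.Periodic (qParam)

variable {τ : ℕ → ℤ}

lemma discriminant_hasSum_tau
    (hτ : ∀ q : ℂ, ‖q‖ < 1 →
      ∑' n : ℕ, (τ (n+1) : ℂ) * q ^ (n+1) = q * ∏' m : ℕ, (1 - q ^ (m+1)) ^ 24) (z : ℍ) :
    HasSum (fun n : ℕ ↦ (τ (n+1) : ℂ) * qParam 1 z ^ (n+1)) (discriminant z) := by
  have h := hτ (qParam 1 z) (Function.Periodic.norm_qParam_lt_one one_pos z.im_pos)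
  have h' : discriminant z = qParam 1 z * ∏' m : ℕ, (1 - qParam 1 z ^ (m+1)) ^ 24 :=
    discriminant_eq_q_prod z
  rw [← h'] at h
  rw [← h]
  refine Summable.hasSum ?_
  by_contra hs
  exact discriminant_ne_zero z (h ▸ tsum_eq_zero_of_not_summable hs)

lemma discriminant_qExpansion_coeff_eq_tau
    (hτ : ∀ q : ℂ, ‖q‖ < 1 →
      ∑' n : ℕ, (τ (n+1) : ℂ) * q ^ (n+1) = q * ∏' m : ℕ, (1 - q ^ (m+1)) ^ 24) (n : ℕ) :
    (qExpansion 1 CuspForm.discriminant).coeff (n + 1) = τ (n + 1) := by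
  let c : ℕ → ℂ := fun m ↦ if m = 0 then 0 else τ m
  have hc : ∀ z : ℍ, HasSum (fun m ↦ c m • qParam 1 z ^ m) (CuspForm.discriminant z) := fun z ↦ by
    rw [← hasSum_nat_add_iff' 1]
    simpa [c] using discriminant_hasSum_tau hτ z
  have := ModularFormClass.qExpansion_coeff_unique (F := CuspForm 𝒮ℒ 12) one_pos
    one_mem_strictPeriods_SL hc (n + 1)
  simpa [c] using this.symm

lemma exists_tau_bound
    (hτ : ∀ q : ℂ, ‖q‖ < 1 →
      ∑' n : ℕ, (τ (n+1) : ℂ) * q ^ (n+1) = q * ∏' m : ℕ, (1 - q ^ (m+1)) ^ 24) :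
    ∃ C : ℝ, 0 < C ∧ ∀ n : ℕ, ‖(τ (n+1) : ℂ)‖ ≤ C * ((n : ℝ) + 1) ^ 6 := by
  have h := CuspFormClass.qExpansion_isBigO CuspForm.discriminant
  rw [Subgroup.strictWidthInfty_SL2Z] at h
  have h2 := (h.comp_tendsto (tendsto_add_atTop_nat 1))
  obtain ⟨C, hC, hb⟩ := Asymptotics.bound_of_isBigO_nat_atTop h2
  refine ⟨C, hC, fun n ↦ ?_⟩
  have hn : (0 : ℝ) ≤ (n : ℝ) + 1 := by positivity
  have h3 := @hb n (by norm_num; positivity)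
  norm_num [-CuspForm.coe_discriminant] at h3
  rwa [discriminant_qExpansion_coeff_eq_tau hτ, abs_of_nonneg hn] at h3

lemma discriminant_neg_inv_coe (z : ℍ) :
    discriminant ⟨(-(z : ℂ))⁻¹, z.im_inv_neg_coe_pos⟩ = (z : ℂ) ^ 12 * discriminant z := by
  have hS := congrFun discriminant_S_invariant z
  rw [SL_slash_apply, UpperHalfPlane.modular_S_smul, ModularGroup.denom_S] at hS
  have hz : (z : ℂ) ^ 12 * (z : ℂ) ^ (-12 : ℤ) = 1 := by
    rw [zpow_neg]
    exact mul_inv_cancel₀ (pow_ne_zero 12 z.ne_zero)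
  rw [mul_comm] at hS
  generalize discriminant z = w at hS ⊢
  rw [← hS, ← mul_assoc, hz, one_mul]

lemma discriminant_tau_inversion
    (hτ : ∀ q : ℂ, ‖q‖ < 1 →
      ∑' n : ℕ, (τ (n+1) : ℂ) * q ^ (n+1) = q * ∏' m : ℕ, (1 - q ^ (m+1)) ^ 24)
    {y : ℝ} (hy : 0 < y) :
    ∑' n : ℕ, (τ (n+1) : ℂ) * (Real.exp (-(2 * π * (n + 1) / y)) : ℂ) =
      (y : ℂ) ^ 12 * ∑' n : ℕ, (τ (n+1) : ℂ) * (Real.exp (-(2 * π * (n + 1) * y)) : ℂ) := by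
  have key : ∀ {t : ℝ} (ht : 0 < t), ∑' n : ℕ, (τ (n+1) : ℂ) *
      (Real.exp (-(2 * π * (n + 1) * t)) : ℂ) = discriminant ⟨t * I, by simpa using ht⟩ := by
    intro t ht
    rw [← (discriminant_hasSum_tau hτ ⟨t * I, by simpa using ht⟩).tsum_eq]
    refine tsum_congr fun n ↦ ?_
    congr 1
    rw [qParam, ← Complex.exp_nat_mul]
    push_cast
    congr 1
    linear_combination -2 * π * (n + 1) * t * I_sq
  have hinv : (0 : ℝ) < 1 / y := by positivity
  have := key hinv
  simp only [mul_one_div] at this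
  rw [key hy, this]
  have hI : (I : ℂ) ^ 12 = 1 := by rw [show 12 = 4 * 3 by rfl, pow_mul, I_pow_four, one_pow]
  have hS := discriminant_neg_inv_coe ⟨y * I, by simpa using hy⟩
  rw [mul_pow, hI, mul_one] at hS
  rw [← hS]
  congr 2
  simp [mul_comm]

end Tau

section Subordination

open Real Set

lemma integrableOn_rpow_neg_half_mul_exp {a b : ℝ} (ha : 0 < a) (hb : 0 < b) :
    IntegrableOn (fun u : ℝ ↦ u ^ (-(1 / 2) : ℝ) * rexp (-(a ^ 2 * u + b ^ 2 / u))) (Ioi 0) := by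
  have h := integrableOn_rpow_mul_exp_neg_mul_rpow (p := 1) (s := -(1 / 2)) (b := a ^ 2)
    (by norm_num) one_pos (by positivity)
  refine Integrable.mono' h ?_ ?_
  · refine ContinuousOn.aestronglyMeasurable ?_ measurableSet_Ioi
    intro u hu
    have hu' : u ≠ 0 := (mem_Ioi.mp hu).ne'
    refine ContinuousAt.continuousWithinAt ?_
    fun_prop (disch := first | assumption | exact Or.inl hu')
  · filter_upwards [self_mem_ae_restrict measurableSet_Ioi] with u hu
    have hu' : (0 : ℝ) < u := hu
    rw [Real.norm_of_nonneg (by positivity), Real.rpow_one]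
    gcongr
    have : 0 ≤ b ^ 2 / u := by positivity
    linarith

/-- The inverse of the Cauchy–Schlömilch substitution `v ↦ a * v - b / v` on `(0, ∞)`. -/
noncomputable def cauchySchlomilchInv (a b x : ℝ) : ℝ := (x + √(x ^ 2 + 4 * a * b)) / (2 * a)

lemma cauchySchlomilchInv_pos {a b : ℝ} (ha : 0 < a) (hb : 0 < b) (x : ℝ) :
    0 < cauchySchlomilchInv a b x := by
  have hab : 0 < 4 * a * b := by positivity
  have : |x| < √(x ^ 2 + 4 * a * b) := by
    rw [← Real.sqrt_sq_eq_abs]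
    exact Real.sqrt_lt_sqrt (sq_nonneg x) (by linarith)
  have := neg_abs_le x
  exact div_pos (by linarith) (by linarith)

lemma cauchySchlomilchInv_left {a b : ℝ} (ha : 0 < a) (hb : 0 < b) (x : ℝ) :
    a * cauchySchlomilchInv a b x - b / cauchySchlomilchInv a b x = x := by
  have hv := cauchySchlomilchInv_pos ha hb x
  have hs : √(x ^ 2 + 4 * a * b) ^ 2 = x ^ 2 + 4 * a * b := Real.sq_sqrt (by positivity)
  have hdef : √(x ^ 2 + 4 * a * b) = 2 * a * cauchySchlomilchInv a b x - x := by
    rw [cauchySchlomilchInv]; field_simp; ring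
  rw [hdef] at hs
  field_simp
  have : 4 * a * (a * cauchySchlomilchInv a b x ^ 2 - b - x * cauchySchlomilchInv a b x) = 0 := by
    linear_combination hs
  have := (mul_eq_zero.mp this).resolve_left (by positivity)
  linarith

lemma cauchySchlomilchInv_right {a b v : ℝ} (ha : 0 < a) (hb : 0 < b) (hv : 0 < v) :
    cauchySchlomilchInv a b (a * v - b / v) = v := by
  have h : (a * v - b / v) ^ 2 + 4 * a * b = (a * v + b / v) ^ 2 := by field_simp; ring
  rw [cauchySchlomilchInv, h, Real.sqrt_sq (by positivity)]
  field_simp; ring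

lemma hasDerivAt_cauchySchlomilchInv {a b : ℝ} (ha : 0 < a) (hb : 0 < b) (x : ℝ) :
    HasDerivAt (cauchySchlomilchInv a b) ((1 + x / √(x ^ 2 + 4 * a * b)) / (2 * a)) x := by
  have h0 : x ^ 2 + 4 * a * b ≠ 0 := by positivity
  have h1 : HasDerivAt (fun x : ℝ ↦ x ^ 2 + 4 * a * b) (2 * x) x := by
    simpa using (hasDerivAt_pow 2 x).add_const (4 * a * b)
  convert! ((hasDerivAt_id x).add (h1.sqrt h0)).div_const (2 * a) using 1
  field_simp

lemma integral_exp_neg_sq_mul_odd_part {c : ℝ} (hc : 0 < c) :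
    Integrable (fun x : ℝ ↦ rexp (-x ^ 2) * (x / √(x ^ 2 + c))) ∧
      ∫ x : ℝ, rexp (-x ^ 2) * (x / √(x ^ 2 + c)) = 0 := by
  constructor
  · have h := integrable_exp_neg_mul_sq one_pos
    refine Integrable.mono' h ?_ (ae_of_all _ fun x ↦ ?_)
    · refine Continuous.aestronglyMeasurable ?_
      have : ∀ x : ℝ, √(x ^ 2 + c) ≠ 0 := fun x ↦ by positivity
      fun_prop (disch := assumption)
    · rw [norm_mul, norm_div, Real.norm_of_nonneg (Real.exp_pos _).le,
        Real.norm_of_nonneg (Real.sqrt_nonneg _), neg_one_mul]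
      refine mul_le_of_le_one_right (Real.exp_pos _).le (div_le_one_of_le₀ ?_ (by positivity))
      rw [Real.norm_eq_abs, ← Real.sqrt_sq_eq_abs]
      exact Real.sqrt_le_sqrt (by linarith)
  · have h := integral_neg_eq_self (fun x : ℝ ↦ rexp (-x ^ 2) * (x / √(x ^ 2 + c))) volume
    simp only [neg_sq, neg_div, mul_neg, integral_neg] at h
    linarith

lemma integral_rpow_neg_half_mul_exp {a b : ℝ} (ha : 0 < a) (hb : 0 < b) :
    ∫ u in Ioi (0 : ℝ), u ^ (-(1 / 2) : ℝ) * rexp (-(a ^ 2 * u + b ^ 2 / u)) =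
      √π / a * rexp (-(2 * a * b)) := by
  set v := cauchySchlomilchInv a b with hv
  set v' : ℝ → ℝ := fun x ↦ (1 + x / √(x ^ 2 + 4 * a * b)) / (2 * a) with hv'
  have hpos : ∀ x, 0 < v x := cauchySchlomilchInv_pos ha hb
  have hleft : ∀ x, a * v x - b / v x = x := cauchySchlomilchInv_left ha hb
  have himage : (fun x ↦ v x ^ 2) '' univ = Ioi 0 := by
    ext u
    simp only [image_univ, mem_range, mem_Ioi]
    refine ⟨fun ⟨x, hx⟩ ↦ hx ▸ pow_pos (hpos x) 2, fun hu ↦ ⟨a * √u - b / √u, ?_⟩⟩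
    rw [hv, cauchySchlomilchInv_right ha hb (Real.sqrt_pos.mpr hu), Real.sq_sqrt hu.le]
  have hinj : InjOn (fun x ↦ v x ^ 2) univ := fun x _ y _ hxy ↦ by
    have : v x = v y := (pow_left_inj₀ (hpos x).le (hpos y).le two_ne_zero).mp hxy
    rw [← hleft x, ← hleft y, this]
  have hderiv : ∀ x ∈ univ, HasDerivWithinAt (fun x ↦ v x ^ 2) (2 * v x * v' x) univ x :=
    fun x _ ↦ HasDerivAt.hasDerivWithinAt
      (by simpa using (hasDerivAt_cauchySchlomilchInv ha hb x).fun_pow 2)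
  have hc : 0 < 4 * a * b := by positivity
  have hv'_nonneg : ∀ x, 0 ≤ v' x := fun x ↦ by
    refine div_nonneg ?_ (by positivity)
    have hs : 0 < √(x ^ 2 + 4 * a * b) := by positivity
    have h1 : |x| ≤ √(x ^ 2 + 4 * a * b) := by
      rw [← Real.sqrt_sq_eq_abs]
      exact Real.sqrt_le_sqrt (by linarith)
    have h2 : -1 ≤ x / √(x ^ 2 + 4 * a * b) := by
      rw [le_div_iff₀ hs]; linarith [neg_abs_le x]
    linarith
  rw [← himage, integral_image_eq_integral_abs_deriv_smul MeasurableSet.univ hderiv hinj,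
    setIntegral_univ]
  have hpt : ∀ x, |2 * v x * v' x| • ((v x ^ 2) ^ (-(1 / 2) : ℝ) *
      rexp (-(a ^ 2 * v x ^ 2 + b ^ 2 / v x ^ 2))) = rexp (-(2 * a * b)) / a *
        (rexp (-x ^ 2) + rexp (-x ^ 2) * (x / √(x ^ 2 + 4 * a * b))) := fun x ↦ by
    have hx := hpos x
    have h1 : a ^ 2 * v x ^ 2 + b ^ 2 / v x ^ 2 = x ^ 2 + 2 * a * b := by
      rw [← congrArg (· ^ 2) (hleft x)]
      field_simp
      ring
    have h2 : (v x ^ 2) ^ (-(1 / 2) : ℝ) = (v x)⁻¹ := by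
      rw [← Real.rpow_natCast, ← Real.rpow_mul hx.le]
      norm_num [Real.rpow_neg_one]
    rw [h1, h2, abs_of_nonneg (mul_nonneg (by positivity) (hv'_nonneg x)), smul_eq_mul, neg_add,
      Real.exp_add, hv']
    field_simp
  simp_rw [hpt]
  obtain ⟨hi, h0⟩ := integral_exp_neg_sq_mul_odd_part hc
  have hg : Integrable fun x : ℝ ↦ rexp (-x ^ 2) := by
    simpa using integrable_exp_neg_mul_sq one_pos
  have hgv : ∫ x : ℝ, rexp (-x ^ 2) = √π := by simpa using integral_gaussian 1
  rw [integral_const_mul, integral_add hg hi, h0, hgv]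
  ring

end Subordination

section Convergence

open Real Set

variable {a : ℕ → ℂ} {C : ℝ}

lemma summable_pow_mul_exp_neg_sqrt (C : ℝ) {ε : ℝ} (hε : 0 < ε) :
    Summable fun n : ℕ ↦ C * ((n : ℝ) + 1) ^ 6 * rexp (-(ε * √((n : ℝ) + 1))) := by
  have hs : Summable fun n : ℕ ↦ (Nat.factorial 16 / ε ^ 16) * (1 / ((n : ℝ) + 1) ^ 2) := by
    refine Summable.mul_left _ ?_
    exact_mod_cast (summable_nat_add_iff 1).mpr (Real.summable_one_div_nat_pow.mpr one_lt_two)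
  simp_rw [mul_assoc]
  refine Summable.mul_left _ (hs.of_nonneg_of_le (fun n ↦ by positivity) fun n ↦ ?_)
  have hn : (0 : ℝ) < (n : ℝ) + 1 := by positivity
  have h := Real.pow_div_factorial_le_exp (x := ε * √((n : ℝ) + 1)) (by positivity) 16
  have h16 : √((n : ℝ) + 1) ^ 16 = ((n : ℝ) + 1) ^ 8 := by
    rw [show 16 = 2 * 8 by rfl, pow_mul, Real.sq_sqrt hn.le]
  rw [mul_pow, h16] at h
  rw [Real.exp_neg]
  calc _ ≤ ((n : ℝ) + 1) ^ 6 * (ε ^ 16 * ((n : ℝ) + 1) ^ 8 / Nat.factorial 16)⁻¹ := by gcongr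
    _ = _ := by field_simp

lemma mul_re_div_norm_le_norm_sq_add {s : ℂ} (hs : 0 < s.re) (c : ℝ) :
    c * (s.re / ‖s‖) ≤ ‖s ^ 2 + c‖ := by
  have h0 : s ≠ 0 := fun h ↦ by simp [h] at hs
  have hn : 0 < ‖s‖ := norm_pos_iff.mpr h0
  have hre : c * (s.re / ‖s‖ ^ 2) ≤ (s + c / s).re := by
    have : (s⁻¹).re = s.re / ‖s‖ ^ 2 := by rw [Complex.inv_re, Complex.normSq_eq_norm_sq]
    rw [Complex.add_re, div_eq_mul_inv (c : ℂ) s, Complex.re_ofReal_mul, this]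
    linarith
  calc c * (s.re / ‖s‖) = ‖s‖ * (c * (s.re / ‖s‖ ^ 2)) := by field_simp
    _ ≤ ‖s‖ * ‖s + c / s‖ := by gcongr; exact hre.trans (Complex.re_le_norm _)
    _ = ‖s ^ 2 + c‖ := by rw [← norm_mul]; congr 1; field_simp

lemma sq_add_ofReal_mem_slitPlane {s : ℂ} (hs : 0 < s.re) {c : ℝ} (hc : 0 ≤ c) :
    s ^ 2 + c ∈ slitPlane := by
  rw [mem_slitPlane_iff]
  by_cases him : s.im = 0
  · left
    simp only [pow_two, add_re, mul_re, him, ofReal_re]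
    nlinarith
  · right
    simp only [pow_two, add_im, mul_im, ofReal_im]
    intro h
    have : s.re * s.im = 0 := by linarith
    rcases mul_eq_zero.mp this with h | h
    · exact hs.ne' h
    · exact him h

lemma cpow_term_norm_le (hC : ∀ n, ‖a n‖ ≤ C * ((n : ℝ) + 1) ^ 6) {ε R : ℝ} (hε : 0 < ε)
    {s : ℂ} (hs : ε < s.re) (hR : ‖s‖ < R) (n : ℕ) :
    ‖s * a n / (s ^ 2 + 16 * (π : ℂ) ^ 2 * (n + 1 : ℕ)) ^ ((25 : ℂ) / 2)‖ ≤
      R * C * (ε / R) ^ (-(25 / 2) : ℝ) * (1 / ((n : ℝ) + 1) ^ (13 / 2 : ℝ)) := by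
  have hsre : 0 < s.re := hε.trans hs
  have hnorm : 0 < ‖s‖ := hsre.trans_le (Complex.re_le_norm s)
  have hR0 : 0 < R := hnorm.trans hR
  have hn : (0 : ℝ) < (n : ℝ) + 1 := by positivity
  have hden : (ε / R) * ((n : ℝ) + 1) ≤ ‖s ^ 2 + 16 * (π : ℂ) ^ 2 * (n + 1 : ℕ)‖ := by
    have h := mul_re_div_norm_le_norm_sq_add hsre (16 * π ^ 2 * ((n : ℝ) + 1))
    push_cast at h ⊢
    refine le_trans ?_ h
    have hπ : 1 ≤ 16 * π ^ 2 := by nlinarith [Real.pi_gt_three]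
    rw [mul_comm]
    gcongr
    nlinarith
  rw [norm_div, norm_mul, show (25 : ℂ) / 2 = ((25 / 2 : ℝ) : ℂ) by push_cast; rfl,
    Complex.norm_cpow_real]
  have hCn := (norm_nonneg _).trans (hC n)
  calc _ ≤ R * (C * ((n : ℝ) + 1) ^ 6) / ((ε / R) * ((n : ℝ) + 1)) ^ (25 / 2 : ℝ) := by
        gcongr
        exact hC n
    _ = _ := by
        rw [Real.mul_rpow (by positivity) hn.le, Real.rpow_neg (by positivity),
          show (25 / 2 : ℝ) = (6 : ℕ) + 13 / 2 by norm_num, Real.rpow_add hn, Real.rpow_natCast]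
        field_simp

lemma summable_cpow_majorant (K : ℝ) :
    Summable fun n : ℕ ↦ K * (1 / ((n : ℝ) + 1) ^ (13 / 2 : ℝ)) := by
  refine Summable.mul_left _ ?_
  exact_mod_cast (summable_nat_add_iff 1).mpr
    (Real.summable_one_div_nat_rpow (p := 13 / 2).mpr (by norm_num))

lemma exp_term_norm_le (hC : ∀ n, ‖a n‖ ≤ C * ((n : ℝ) + 1) ^ 6) {ε : ℝ}
    {s : ℂ} (hs : ε ≤ s.re) (n : ℕ) :
    ‖a n * cexp (-(s * √((n : ℝ) + 1)))‖ ≤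
      C * ((n : ℝ) + 1) ^ 6 * rexp (-(ε * √((n : ℝ) + 1))) := by
  have hCn := (norm_nonneg _).trans (hC n)
  rw [norm_mul, Complex.norm_exp, Complex.neg_re, Complex.re_mul_ofReal]
  gcongr
  exact hC n

lemma summable_exp_term (hC : ∀ n, ‖a n‖ ≤ C * ((n : ℝ) + 1) ^ 6) {s : ℂ} (hs : 0 < s.re) :
    Summable fun n : ℕ ↦ a n * cexp (-(s * √((n : ℝ) + 1))) :=
  (summable_pow_mul_exp_neg_sqrt C hs).of_norm_bounded (exp_term_norm_le hC le_rfl)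

lemma summable_cpow_term (hC : ∀ n, ‖a n‖ ≤ C * ((n : ℝ) + 1) ^ 6) {s : ℂ} (hs : 0 < s.re) :
    Summable fun n : ℕ ↦
      s * a n / (s ^ 2 + 16 * (π : ℂ) ^ 2 * (n + 1 : ℕ)) ^ ((25 : ℂ) / 2) :=
  (summable_cpow_majorant _).of_norm_bounded
    (cpow_term_norm_le hC (half_pos hs) (half_lt_self hs) (lt_add_one ‖s‖))

lemma isOpen_re_gt_inter_ball (ε R : ℝ) : IsOpen {s : ℂ | ε < s.re ∧ ‖s‖ < R} :=
  (isOpen_lt continuous_const Complex.continuous_re).inter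
    (isOpen_lt continuous_norm continuous_const)

lemma differentiableOn_tsum_exp_term (hC : ∀ n, ‖a n‖ ≤ C * ((n : ℝ) + 1) ^ 6) :
    DifferentiableOn ℂ (fun s : ℂ ↦ ∑' n : ℕ, a n * cexp (-(s * √((n : ℝ) + 1))))
      {s | 0 < s.re} := by
  intro s hs
  have hs : 0 < s.re := hs
  have ho : IsOpen {w : ℂ | s.re / 2 < w.re} := isOpen_lt continuous_const continuous_re
  have h := differentiableOn_tsum_of_summable_norm (summable_pow_mul_exp_neg_sqrt C (half_pos hs))
    (fun n ↦ by fun_prop) ho (fun n w (hw : s.re / 2 < w.re) ↦ exp_term_norm_le hC hw.le n)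
  exact (h.differentiableAt (ho.mem_nhds (half_lt_self hs))).differentiableWithinAt

lemma differentiableOn_tsum_cpow_term (hC : ∀ n, ‖a n‖ ≤ C * ((n : ℝ) + 1) ^ 6) :
    DifferentiableOn ℂ (fun s : ℂ ↦ ∑' n : ℕ,
      s * a n / (s ^ 2 + 16 * (π : ℂ) ^ 2 * (n + 1 : ℕ)) ^ ((25 : ℂ) / 2)) {s | 0 < s.re} := by
  intro s hs
  have hs : 0 < s.re := hs
  have ho := isOpen_re_gt_inter_ball (s.re / 2) (‖s‖ + 1)
  have h := differentiableOn_tsum_of_summable_norm (summable_cpow_majorant _)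
    (F := fun (n : ℕ) (s : ℂ) ↦
      s * a n / (s ^ 2 + 16 * (π : ℂ) ^ 2 * (n + 1 : ℕ)) ^ ((25 : ℂ) / 2))
    (fun n w hw ↦ ?_) ho (fun n w hw ↦ cpow_term_norm_le hC (half_pos hs) hw.1 hw.2 n)
  · exact (h.differentiableAt
      (ho.mem_nhds ⟨half_lt_self hs, lt_add_one _⟩)).differentiableWithinAt
  · have hslit : w ^ 2 + 16 * (π : ℂ) ^ 2 * (n + 1 : ℕ) ∈ slitPlane := by
      have := sq_add_ofReal_mem_slitPlane ((half_pos hs).trans hw.1)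
        (c := 16 * π ^ 2 * (n + 1 : ℕ)) (by positivity)
      exact_mod_cast this
    refine DifferentiableAt.differentiableWithinAt ?_
    refine DifferentiableAt.div (by fun_prop) ?_ ?_
    · exact DifferentiableAt.cpow_const (by fun_prop) hslit
    · exact (cpow_ne_zero_iff_of_exponent_ne_zero (by norm_num)).mpr (slitPlane_ne_zero hslit)

lemma eqOn_re_pos_of_forall_ofReal {f g : ℂ → ℂ} (hf : DifferentiableOn ℂ f {s | 0 < s.re})
    (hg : DifferentiableOn ℂ g {s | 0 < s.re}) (h : ∀ x : ℝ, 0 < x → f x = g x) :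
    EqOn f g {s | 0 < s.re} := by
  have ho : IsOpen {s : ℂ | 0 < s.re} := isOpen_lt continuous_const continuous_re
  refine (hf.analyticOnNhd ho).eqOn_of_preconnected_of_frequently_eq (hg.analyticOnNhd ho)
    (convex_halfSpace_re_gt 0).isPreconnected (z₀ := ((1 : ℝ) : ℂ)) (by simp) ?_
  have ht : Tendsto (fun x : ℝ ↦ (x : ℂ)) (nhdsWithin 1 (Ioi 1))
      (nhdsWithin ((1 : ℝ) : ℂ) {((1 : ℝ) : ℂ)}ᶜ) := by
    refine tendsto_nhdsWithin_iff.mpr ⟨?_, ?_⟩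
    · exact continuous_ofReal.continuousAt.tendsto.mono_left nhdsWithin_le_nhds
    · filter_upwards [self_mem_nhdsWithin] with x hx
      simpa using (mem_Ioi.mp hx).ne'
  refine ht.frequently (Eventually.frequently ?_)
  filter_upwards [self_mem_nhdsWithin] with x hx using h x (one_pos.trans hx)

end Convergence

section RealIdentity

open Real Set

variable {a : ℕ → ℂ} {C : ℝ}

lemma hasSum_mul_integral_Ioi {f : ℕ → ℝ → ℝ} (hf : ∀ n, IntegrableOn (f n) (Ioi 0))
    (hf0 : ∀ n, ∀ u ∈ Ioi (0 : ℝ), 0 ≤ f n u)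
    (hs : Summable fun n ↦ ‖a n * ((∫ u in Ioi (0 : ℝ), f n u : ℝ) : ℂ)‖) :
    HasSum (fun n ↦ a n * ((∫ u in Ioi (0 : ℝ), f n u : ℝ) : ℂ))
      (∫ u in Ioi (0 : ℝ), ∑' n, a n * (f n u : ℂ)) := by
  have h := hasSum_integral_of_summable_integral_norm (μ := volume.restrict (Ioi (0 : ℝ)))
    (F := fun n u ↦ a n * (f n u : ℂ)) (fun n ↦ (hf n).ofReal.const_mul _) ?_
  · simpa only [integral_const_mul, integral_complex_ofReal] using h
  · convert hs using 2 with n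
    rw [norm_mul, Complex.norm_real,
      Real.norm_of_nonneg (setIntegral_nonneg measurableSet_Ioi (hf0 n)), ← integral_const_mul]
    refine setIntegral_congr_fun measurableSet_Ioi fun u hu ↦ ?_
    simp [abs_of_nonneg (hf0 n u hu)]

lemma integral_gamma_kernel {x k : ℝ} (hk : 0 < x ^ 2 + 4 * k) :
    ∫ u in Ioi (0 : ℝ), u ^ (23 / 2 : ℝ) * rexp (-((x ^ 2 / 4 + k) * u)) =
      2 ^ 25 * Real.Gamma (25 / 2) / (x ^ 2 + 4 * k) ^ (25 / 2 : ℝ) := by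
  have h := Real.integral_rpow_mul_exp_neg_mul_Ioi (a := 25 / 2) (r := x ^ 2 / 4 + k)
    (by norm_num) (by linarith)
  rw [show (25 / 2 - 1 : ℝ) = 23 / 2 by norm_num] at h
  have h4 : (4 : ℝ) ^ (25 / 2 : ℝ) = 2 ^ 25 := by
    rw [show (4 : ℝ) = 2 ^ (2 : ℝ) by norm_num, ← Real.rpow_mul (by norm_num),
      ← Real.rpow_natCast]
    norm_num
  rw [h, show 1 / (x ^ 2 / 4 + k) = 4 / (x ^ 2 + 4 * k) by field_simp,
    Real.div_rpow (by norm_num) hk.le, h4]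
  ring

lemma integrableOn_gamma_kernel {r : ℝ} (hr : 0 < r) :
    IntegrableOn (fun u : ℝ ↦ u ^ (23 / 2 : ℝ) * rexp (-(r * u))) (Ioi 0) := by
  simpa using integrableOn_rpow_mul_exp_neg_mul_rpow (p := 1) (s := 23 / 2) (b := r)
    (by norm_num) one_pos hr

lemma tsum_exp_eq_tsum_cpow_of_real (hC : ∀ n, ‖a n‖ ≤ C * ((n : ℝ) + 1) ^ 6)
    (hinv : ∀ y : ℝ, 0 < y →
      ∑' n : ℕ, a n * (rexp (-(2 * π * (n + 1) / y)) : ℂ) =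
        (y : ℂ) ^ 12 * ∑' n : ℕ, a n * (rexp (-(2 * π * (n + 1) * y)) : ℂ))
    {x : ℝ} (hx : 0 < x) :
    ∑' n : ℕ, a n * cexp (-(x * √((n : ℝ) + 1))) =
      2 ^ 36 * (π : ℂ) ^ ((23 : ℂ) / 2) * Complex.Gamma (25 / 2) *
        ∑' n : ℕ, x * a n / ((x : ℂ) ^ 2 + 16 * (π : ℂ) ^ 2 * (n + 1 : ℕ)) ^ ((25 : ℂ) / 2) := by
  have hxre : 0 < (x : ℂ).re := by simpa using hx
  have hxc : (x : ℂ) ≠ 0 := by exact_mod_cast hx.ne'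
  set D : ℕ → ℝ := fun n ↦ x ^ 2 + 4 * (4 * π ^ 2 * ((n : ℝ) + 1)) with hD
  have hDpos : ∀ n, 0 < D n := fun n ↦ by positivity
  have hDc : ∀ n : ℕ, ((x : ℂ) ^ 2 + 16 * (π : ℂ) ^ 2 * (n + 1 : ℕ)) ^ ((25 : ℂ) / 2) =
      ((D n ^ (25 / 2 : ℝ) : ℝ) : ℂ) := fun n ↦ by
    rw [Complex.ofReal_cpow (hDpos n).le, hD]
    push_cast
    ring_nf
  -- the exponential series as an integral
  let f : ℕ → ℝ → ℝ := fun n u ↦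
    u ^ (-(1 / 2) : ℝ) * rexp (-((x / 2) ^ 2 * u + √((n : ℝ) + 1) ^ 2 / u))
  have hfint : ∀ n, ((∫ u in Ioi (0 : ℝ), f n u : ℝ) : ℂ) =
      (2 * √π / x : ℝ) * cexp (-(x * √((n : ℝ) + 1))) := fun n ↦ by
    rw [integral_rpow_neg_half_mul_exp (half_pos hx) (by positivity)]
    rw [show 2 * (x / 2) * √((n : ℝ) + 1) = x * √((n : ℝ) + 1) by ring,
      show √π / (x / 2) = 2 * √π / x by field_simp]
    push_cast
    rfl
  have hfsum := hasSum_mul_integral_Ioi (a := a) (f := f)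
    (fun n ↦ integrableOn_rpow_neg_half_mul_exp (half_pos hx) (by positivity))
    (fun n u (hu : 0 < u) ↦ by positivity)
    (by
      simp_rw [hfint, mul_left_comm (a _)]
      exact ((summable_exp_term hC hxre).mul_left _).norm)
  -- the second series as an integral
  let g : ℕ → ℝ → ℝ := fun n u ↦
    u ^ (23 / 2 : ℝ) * rexp (-((x ^ 2 / 4 + 4 * π ^ 2 * ((n : ℝ) + 1)) * u))
  have hgint : ∀ n, a n * ((∫ u in Ioi (0 : ℝ), g n u : ℝ) : ℂ) =
      (2 ^ 25 * Real.Gamma (25 / 2) / x : ℝ) *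
        (x * a n / ((x : ℂ) ^ 2 + 16 * (π : ℂ) ^ 2 * (n + 1 : ℕ)) ^ ((25 : ℂ) / 2)) := fun n ↦ by
    rw [show ∫ u in Ioi (0 : ℝ), g n u = 2 ^ 25 * Real.Gamma (25 / 2) / D n ^ (25 / 2 : ℝ) from
      integral_gamma_kernel (hDpos n), hDc]
    push_cast
    field_simp
  have hgsum := hasSum_mul_integral_Ioi (a := a) (f := g)
    (fun n ↦ integrableOn_gamma_kernel (by positivity))
    (fun n u (hu : 0 < u) ↦ by positivity)
    (by
      simp_rw [hgint]
      exact ((summable_cpow_term hC hxre).mul_left _).norm)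
  -- the two integrands agree by modularity
  have hfg : ∫ u in Ioi (0 : ℝ), ∑' n, a n * (f n u : ℂ) =
      (2 * π : ℂ) ^ 12 * ∫ u in Ioi (0 : ℝ), ∑' n, a n * (g n u : ℂ) := by
    rw [← integral_const_mul]
    refine setIntegral_congr_fun measurableSet_Ioi fun u (hu : 0 < u) ↦ ?_
    have h1 : ∀ n : ℕ, a n * (f n u : ℂ) = (u ^ (-(1 / 2) : ℝ) * rexp (-(x ^ 2 / 4 * u)) : ℝ) *
        (a n * (rexp (-(2 * π * (n + 1) / (2 * π * u))) : ℂ)) := fun n ↦ by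
      have : f n u = u ^ (-(1 / 2) : ℝ) * rexp (-(x ^ 2 / 4 * u)) *
          rexp (-(2 * π * (n + 1) / (2 * π * u))) := by
        rw [mul_assoc, ← Real.exp_add]
        simp only [f]
        rw [Real.sq_sqrt (by positivity)]
        congr 2
        field_simp
        ring
      rw [this]
      push_cast
      ring
    have h2 : ∀ n : ℕ, a n * (g n u : ℂ) = (u ^ (23 / 2 : ℝ) * rexp (-(x ^ 2 / 4 * u)) : ℝ) *
        (a n * (rexp (-(2 * π * (n + 1) * (2 * π * u))) : ℂ)) := fun n ↦ by
      have : g n u = u ^ (23 / 2 : ℝ) * rexp (-(x ^ 2 / 4 * u)) *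
          rexp (-(2 * π * (n + 1) * (2 * π * u))) := by
        rw [mul_assoc, ← Real.exp_add]
        simp only [g]
        congr 2
        ring
      rw [this]
      push_cast
      ring
    have hpow : u ^ (23 / 2 : ℝ) = u ^ (-(1 / 2) : ℝ) * u ^ 12 := by
      rw [← Real.rpow_natCast, ← Real.rpow_add hu]
      norm_num
    simp_rw [h1, h2, tsum_mul_left]
    rw [hinv (2 * π * u) (by positivity), hpow]
    push_cast
    ring
  have hF := hfsum.tsum_eq
  have hG := hgsum.tsum_eq
  simp_rw [hfint, mul_left_comm (a _)] at hF
  simp_rw [hgint] at hG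
  rw [tsum_mul_left] at hF hG
  rw [hfg, ← hG] at hF
  have hsqrt : (√π : ℂ) ≠ 0 := by exact_mod_cast (Real.sqrt_pos.mpr Real.pi_pos).ne'
  have hpi : (π : ℂ) ^ ((23 : ℂ) / 2) * √π = (π : ℂ) ^ 12 := by
    have : π ^ (23 / 2 : ℝ) * √π = π ^ 12 := by
      rw [Real.sqrt_eq_rpow, ← Real.rpow_add Real.pi_pos, ← Real.rpow_natCast]
      norm_num
    rw [← Complex.ofReal_pow, ← this, Complex.ofReal_mul, Complex.ofReal_cpow Real.pi_pos.le]
    push_cast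
    rfl
  have hΓ : Complex.Gamma (25 / 2) = (Real.Gamma (25 / 2) : ℂ) := by
    rw [← Complex.Gamma_ofReal]; push_cast; rfl
  have hmul : 2 * (√π : ℂ) / x ≠ 0 := div_ne_zero (mul_ne_zero two_ne_zero hsqrt) hxc
  rw [hΓ]
  generalize ∑' n : ℕ, x * a n /
    ((x : ℂ) ^ 2 + 16 * (π : ℂ) ^ 2 * (n + 1 : ℕ)) ^ ((25 : ℂ) / 2) = T at hF ⊢
  generalize (π : ℂ) ^ ((23 : ℂ) / 2) = p at hpi ⊢
  push_cast at hF
  refine mul_left_cancel₀ hmul (hF.trans ?_)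
  linear_combination (-2 ^ 37 * (Real.Gamma (25 / 2) : ℂ) / x * T) * hpi

end RealIdentity

/-- **An identity of Chandrasekharan and Narasimhan.**  Let `τ` be the Ramanujan tau function,
i.e. the function satisfying `∑_{n=1}^∞ τ(n) qⁿ = q ∏_{m=1}^∞ (1 - qᵐ)²⁴` for `|q| < 1`.
Then for `Re s > 0`,
`∑_{n=1}^∞ τ(n) e^{-s√n} = 2³⁶ π^{23/2} Γ(25/2) ∑_{n=1}^∞ s τ(n)/(s² + 16π²n)^{25/2}`,
both series converging absolutely. -/
theorem tau_exponential_identity (τ : ℕ → ℤ)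
    (hτ : ∀ q : ℂ, ‖q‖ < 1 →
      ∑' n : ℕ, (τ (n+1) : ℂ) * q ^ (n+1) = q * ∏' m : ℕ, (1 - q ^ (m+1)) ^ 24)
    (s : ℂ) (hs : 0 < s.re) :
    Summable (fun n : ℕ => (τ (n+1) : ℂ) * Complex.exp (-(s * Real.sqrt (n+1)))) ∧
    Summable (fun n : ℕ =>
      s * (τ (n+1) : ℂ) / (s^2 + 16 * (Real.pi : ℂ)^2 * (n+1 : ℕ)) ^ ((25:ℂ)/2)) ∧
    ∑' n : ℕ, (τ (n+1) : ℂ) * Complex.exp (-(s * Real.sqrt (n+1)))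
      = 2^36 * (Real.pi : ℂ) ^ ((23:ℂ)/2) * Complex.Gamma (25/2)
        * ∑' n : ℕ,
            s * (τ (n+1) : ℂ) / (s^2 + 16 * (Real.pi : ℂ)^2 * (n+1 : ℕ)) ^ ((25:ℂ)/2) := by
  obtain ⟨C, -, hC⟩ := exists_tau_bound hτ
  exact ⟨summable_exp_term hC hs, summable_cpow_term hC hs,
    eqOn_re_pos_of_forall_ofReal (differentiableOn_tsum_exp_term hC)
      ((differentiableOn_tsum_cpow_term hC).const_mul _)
      (fun x hx ↦ tsum_exp_eq_tsum_cpow_of_real hC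
        (fun y hy ↦ discriminant_tau_inversion hτ hy) hx) hs⟩
end
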